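/- For every integer n ≥ 62, the 3×3 determinant with rows (Δ\bar{p}(n+2), Δ\bar{p}(n+3), Δ\bar{p}(n+4)), (Δ\bar{p}(n+1), Δ\bar{p}(n+2), Δ\bar{p}(n+3)), (Δ\bar{p}(n), Δ\bar{p}(n+1), Δ\bar{p}(n+2)) is strictly positive. -/

import Mathlib

/-- The overpartition function: `Σ_{λ ⊢ n} 2^{d(λ)}` where `d(λ)` is the number of
distinct part sizes of the partition `λ`. -/
def overpartitionFn (n : ℕ) : ℕ :=
  ∑ μ : Nat.Partition n, 2 ^ μ.parts.toFinset.card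

/-- The first-order forward difference of the overpartition function, as an integer. -/
def dPbar (n : ℕ) : ℤ := (overpartitionFn (n + 1) : ℤ) - overpartitionFn n

namespace Overpartition

open PowerSeries Filter Topology

section PowerSeries

open scoped PowerSeries.WithPiTopology

/-- The power series of `(1 + X ^ (k + 1)) / (1 - X ^ (k + 1))`. -/
noncomputable def factor (k : ℕ) : ℝ⟦X⟧ :=
  PowerSeries.mk fun n => if n = 0 then 1 else if (k + 1) ∣ n then 2 else 0

/-- The overpartition generating function as a formal power series. -/
noncomputable def series : ℝ⟦X⟧ := PowerSeries.mk fun n => (overpartitionFn n : ℝ)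

/-- The formal theta series `∑ (-1)^k X^(k^2)`, summed over all integers `k`. -/
noncomputable def thetaSeries : ℝ⟦X⟧ :=
  PowerSeries.mk fun n => if n = 0 then 1 else if IsSquare n then 2 * (-1) ^ n else 0

lemma factor_mul (k : ℕ) : factor k * (1 - X ^ (k + 1)) = 1 + X ^ (k + 1) := by
  ext n
  rw [mul_sub, mul_one, map_sub, map_add, coeff_mul_X_pow', coeff_one, coeff_X_pow]
  simp only [factor, coeff_mk]
  rcases Nat.eq_zero_or_pos n with rfl | hn
  · simp
  rcases lt_trichotomy n (k + 1) with h | h | h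
  · have : ¬ (k + 1) ∣ n := fun hd => absurd (Nat.le_of_dvd hn hd) (by omega)
    rw [if_neg (by omega), if_neg this, if_neg (by omega), if_neg (by omega), if_neg (by omega)]
    simp
  · subst h
    simp
    norm_num
  · have hdvd : (k + 1) ∣ n - (k + 1) ↔ (k + 1) ∣ n := Nat.dvd_sub_iff_left h.le dvd_rfl
    have h1 : ¬ n = 0 := by omega
    have h2 : ¬ n - (k + 1) = 0 := by omega
    have h3 : ¬ n = k + 1 := by omega
    simp only [h1, h2, h3, hdvd, h.le, if_true, if_false]
    simp

lemma one_sub_X_pow_ne_zero (k : ℕ) : (1 - X ^ (k + 1) : ℝ⟦X⟧) ≠ 0 := by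
  intro h
  have := congrArg (coeff 0) h
  simp at this

lemma factor_eq_tsum (k : ℕ) :
    (1 + ∑' j : ℕ, (2 : ℝ) • (X : ℝ⟦X⟧) ^ ((k + 1) * (j + 1))) = factor k := by
  apply mul_right_cancel₀ (one_sub_X_pow_ne_zero k)
  rw [factor_mul]
  have h0 : constantCoeff ((X : ℝ⟦X⟧) ^ (k + 1)) = 0 := by simp
  have h := PowerSeries.WithPiTopology.tsum_pow_mul_one_sub_of_constantCoeff_eq_zero h0
  have hs := PowerSeries.WithPiTopology.summable_pow_of_constantCoeff_eq_zero h0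
  have : ∀ j : ℕ, (2 : ℝ) • (X : ℝ⟦X⟧) ^ ((k + 1) * (j + 1)) =
      (2 * X ^ (k + 1)) * (X ^ (k + 1)) ^ j := by
    intro j
    rw [← pow_mul, mul_assoc, ← pow_add, smul_eq_C_mul, map_ofNat]
    ring
  simp_rw [this]
  rw [hs.tsum_mul_left, add_mul, mul_assoc, h]
  ring

lemma series_eq_genFun : series = Nat.Partition.genFun fun _ _ => (2 : ℝ) := by
  ext n
  simp [series, overpartitionFn, Finsupp.prod, Multiset.toFinsupp_support]

lemma hasProd_factor : HasProd factor series := by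
  rw [series_eq_genFun]
  simpa only [factor_eq_tsum] using Nat.Partition.hasProd_genFun (fun _ _ => (2 : ℝ))

lemma tendsto_prod_factor :
    Tendsto (fun K => ∏ k ∈ Finset.range K, factor k) atTop (𝓝 series) :=
  hasProd_factor.tendsto_prod_nat

lemma tendsto_coeff_prod_factor (n : ℕ) :
    Tendsto (fun K => coeff n (∏ k ∈ Finset.range K, factor k)) atTop
      (𝓝 (overpartitionFn n : ℝ)) := by
  have := (PowerSeries.WithPiTopology.tendsto_iff_coeff_tendsto ℝ _ _ _).1 tendsto_prod_factor n
  simpa [series] using this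

lemma coeff_factor_nonneg (k n : ℕ) : 0 ≤ coeff n (factor k) := by
  simp only [factor, coeff_mk]
  split_ifs <;> norm_num

lemma coeff_mul_nonneg {f g : ℝ⟦X⟧} (hf : ∀ n, 0 ≤ coeff n f) (hg : ∀ n, 0 ≤ coeff n g) (n : ℕ) :
    0 ≤ coeff n (f * g) := by
  rw [coeff_mul]
  exact Finset.sum_nonneg fun _ _ => mul_nonneg (hf _) (hg _)

lemma coeff_prod_factor_nonneg (K n : ℕ) : 0 ≤ coeff n (∏ k ∈ Finset.range K, factor k) := by
  induction K generalizing n with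
  | zero => simp only [Finset.range_zero, Finset.prod_empty, coeff_one]; split_ifs <;> norm_num
  | succ K ih =>
    rw [Finset.prod_range_succ]
    exact coeff_mul_nonneg ih (coeff_factor_nonneg K) n

lemma coeff_prod_factor_mono (n : ℕ) :
    Monotone fun K => coeff n (∏ k ∈ Finset.range K, factor k) := by
  refine monotone_nat_of_le_succ fun K => ?_
  rw [Finset.prod_range_succ, coeff_mul]
  have hmem : (n, 0) ∈ Finset.HasAntidiagonal.antidiagonal n := by simp
  have := Finset.single_le_sum (f := fun p : ℕ × ℕ =>
    coeff p.1 (∏ k ∈ Finset.range K, factor k) * coeff p.2 (factor K))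
    (fun p _ => mul_nonneg (coeff_prod_factor_nonneg K _) (coeff_factor_nonneg K _)) hmem
  simpa [factor] using this

lemma coeff_prod_factor_le (K n : ℕ) :
    coeff n (∏ k ∈ Finset.range K, factor k) ≤ overpartitionFn n :=
  (coeff_prod_factor_mono n).ge_of_tendsto (tendsto_coeff_prod_factor n) K

/-- The telescoping step behind the finite form of the Gauss identity. -/
lemma sum_telescope {R : Type*} [CommRing R] (x : R) (a b w : ℕ → R)
    (hb : ∀ s, 1 ≤ s → b s * (1 + x ^ s) = 1) (ha : ∀ s, a s = (1 - x ^ s) * b s)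
    (hw : w 0 = 1) (hw' : ∀ s, 1 ≤ s → w s = 2 * b s) (n : ℕ) :
    ∑ s ∈ Finset.range (n + 1),
      (-1) ^ s * w s * (∏ k ∈ Finset.Ico (s + 1) (n + 1), a k) * x ^ (s * (n + 1)) =
    1 + 2 * ∑ j ∈ Finset.range n, (-1) ^ (j + 1) * x ^ ((j + 1) ^ 2) := by
  induction n with
  | zero => simp [hw]
  | succ n ih =>
    rw [Finset.sum_range_succ _ n, mul_add, ← add_assoc, ← ih]
    have hN := hb (n + 1) (by omega)
    have key : ∀ m ≤ n + 1, ∑ s ∈ Finset.range m,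
        ((-1) ^ s * w s * (∏ k ∈ Finset.Ico (s + 1) (n + 2), a k) * x ^ (s * (n + 2)) -
          (-1) ^ s * w s * (∏ k ∈ Finset.Ico (s + 1) (n + 1), a k) * x ^ (s * (n + 1))) =
        if m = 0 then 0 else 2 * b (n + 1) * (-1) ^ m *
          (∏ k ∈ Finset.Ico m (n + 1), a k) * x ^ (m * (n + 1)) := by
      intro m hm
      induction m with
      | zero => simp
      | succ m ihm =>
        rw [Finset.sum_range_succ, ihm (by omega), if_neg (by omega : ¬ m + 1 = 0)]
        rw [Finset.prod_Ico_succ_top (by omega : m + 1 ≤ n + 1), ha (n + 1)]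
        rcases Nat.eq_zero_or_pos m with rfl | hm0
        · simp only [hw]
          simp
          linear_combination (∏ k ∈ Finset.Ico 1 (n + 1), a k) * hN
        · rw [if_neg (by omega), Finset.prod_eq_prod_Ico_succ_bot (by omega : m < n + 1), ha m,
            hw' m hm0]
          have hm1 := hb m hm0
          have e1 : x ^ (m * (n + 2)) = x ^ (m * (n + 1)) * x ^ m := by ring
          have e2 : x ^ ((m + 1) * (n + 1)) = x ^ (m * (n + 1)) * x ^ (n + 1) := by ring
          rw [e1, e2, pow_succ (-1 : R) m]
          linear_combination ((-1) ^ m * (∏ k ∈ Finset.Ico (m + 1) (n + 1), a k) *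
            x ^ (m * (n + 1)) * 2) * (b m * hN - b (n + 1) * x ^ (n + 1) * hm1)
    have hk := key (n + 1) le_rfl
    rw [if_neg (by omega), Finset.sum_sub_distrib, Finset.Ico_self, Finset.prod_empty] at hk
    rw [Finset.sum_range_succ, Finset.Ico_self, Finset.prod_empty, hw' (n + 1) (by omega)]
    have e1 : x ^ ((n + 1) * (n + 1 + 1)) = x ^ ((n + 1) ^ 2) * x ^ (n + 1) := by ring
    have e2 : x ^ ((n + 1) * (n + 1)) = x ^ ((n + 1) ^ 2) := by ring
    rw [e1]
    rw [e2] at hk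
    linear_combination hk + 2 * (-1) ^ (n + 1) * x ^ ((n + 1) ^ 2) * hN

lemma coeff_thetaPartial {K d : ℕ} (hd : d < K + 1) :
    coeff d (1 + 2 * ∑ j ∈ Finset.range K, (-1) ^ (j + 1) * (X : ℝ⟦X⟧) ^ ((j + 1) ^ 2)) =
      coeff d thetaSeries := by
  have h2 : (2 : ℝ⟦X⟧) = C (2 : ℝ) := (map_ofNat C 2).symm
  have h1 : ∀ j : ℕ, ((-1) ^ (j + 1) : ℝ⟦X⟧) = C ((-1 : ℝ) ^ (j + 1)) := by intro j; simp
  rw [map_add, h2, coeff_C_mul, map_sum]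
  simp_rw [h1, coeff_C_mul, coeff_X_pow, coeff_one]
  simp only [thetaSeries, coeff_mk]
  rcases Nat.eq_zero_or_pos d with rfl | hd0
  · have : ∀ j : ℕ, ¬ (0 = (j + 1) ^ 2) := fun j h => absurd h (by positivity)
    simp [this]
  rw [if_neg (by omega), if_neg (by omega)]
  split_ifs with hsq
  · obtain ⟨m, rfl⟩ := hsq
    have hm : 1 ≤ m := Nat.pos_of_ne_zero (by rintro rfl; simp at hd0)
    have hmK : m - 1 < K := by nlinarith [Nat.sub_add_cancel hm]
    rw [Finset.sum_eq_single_of_mem (m - 1) (Finset.mem_range.2 hmK)]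
    · rw [Nat.sub_add_cancel hm, if_pos (by ring), pow_mul]
      rcases Nat.even_or_odd m with h | h
      · simp [h.neg_one_pow]
      · simp [h.neg_one_pow]
    · intro j _ hj
      rw [if_neg, mul_zero]
      intro h
      have : m = j + 1 := by
        have h' : m ^ 2 = (j + 1) ^ 2 := by rw [← h]; ring
        exact Nat.pow_left_injective (n := 2) (by norm_num) h'
      omega
  · rw [Finset.sum_eq_zero]
    · simp
    · intro j _
      rw [if_neg, mul_zero]
      rintro rfl
      exact hsq ⟨j + 1, by ring⟩

lemma coeff_prod_factor_mul_thetaSeries {K d : ℕ} (hd : d < K + 1) :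
    coeff d ((∏ k ∈ Finset.range K, factor k) * thetaSeries) = coeff d (1 : ℝ⟦X⟧) := by
  set b : ℕ → ℝ⟦X⟧ := fun s => (1 + X ^ s)⁻¹ with hbdef
  have hb : ∀ s, 1 ≤ s → b s * (1 + X ^ s) = 1 := by
    intro s hs
    refine PowerSeries.inv_mul_cancel _ ?_
    simp [show s ≠ 0 by omega]
  have key := sum_telescope (X : ℝ⟦X⟧) (fun s => (1 - X ^ s) * b s) b
    (fun s => if s = 0 then 1 else 2 * b s) hb (fun _ => rfl) (by simp)
    (fun s hs => by rw [if_neg (by omega)]) K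
  rw [Finset.sum_range_succ'] at key
  have hprod : (∏ k ∈ Finset.range K, factor k) *
      ∏ k ∈ Finset.Ico 1 (K + 1), ((1 - X ^ k) * b k) = 1 := by
    rw [Finset.prod_Ico_eq_prod_range, Nat.add_sub_cancel, ← Finset.prod_mul_distrib]
    refine Finset.prod_eq_one fun k _ => ?_
    rw [← mul_assoc, add_comm 1 k, factor_mul, mul_comm]
    exact hb (k + 1) (by omega)
  have hdvd : (X : ℝ⟦X⟧) ^ (K + 1) ∣ (∏ k ∈ Finset.range K, factor k) * thetaSeries - 1 := by
    have h1 : (X : ℝ⟦X⟧) ^ (K + 1) ∣ thetaSeries -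
        (1 + 2 * ∑ j ∈ Finset.range K, (-1) ^ (j + 1) * (X : ℝ⟦X⟧) ^ ((j + 1) ^ 2)) := by
      rw [X_pow_dvd_iff]
      intro m hm
      rw [map_sub, coeff_thetaPartial hm, sub_self]
    have h2 : (X : ℝ⟦X⟧) ^ (K + 1) ∣
        (1 + 2 * ∑ j ∈ Finset.range K, (-1) ^ (j + 1) * (X : ℝ⟦X⟧) ^ ((j + 1) ^ 2)) -
          ∏ k ∈ Finset.Ico 1 (K + 1), ((1 - X ^ k) * b k) := by
      rw [← key]
      simp only [pow_zero, if_true, zero_mul, mul_one, zero_add, one_mul, add_sub_cancel_right]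
      refine Finset.dvd_sum fun s _ => Dvd.dvd.mul_left ?_ _
      exact pow_dvd_pow _ (Nat.le_mul_of_pos_left _ (by omega))
    have h3 := (dvd_add h1 h2).mul_left (∏ k ∈ Finset.range K, factor k)
    rwa [sub_add_sub_cancel, mul_sub, hprod] at h3
  have := X_pow_dvd_iff.1 hdvd d hd
  rwa [map_sub, sub_eq_zero] at this

/-- The Gauss identity: the overpartition series is the inverse of the theta series. -/
theorem series_mul_thetaSeries : series * thetaSeries = 1 := by
  ext d
  have h := (PowerSeries.WithPiTopology.tendsto_iff_coeff_tendsto ℝ _ _ _).1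
    (tendsto_prod_factor.mul_const thetaSeries) d
  refine tendsto_nhds_unique h (tendsto_const_nhds.congr' ?_)
  filter_upwards [eventually_ge_atTop d] with K hK
  exact (coeff_prod_factor_mul_thetaSeries (by omega)).symm

end PowerSeries

section Evaluation

/-- The power series `f` converges absolutely at `q`, with sum `s`. -/
def EvalsTo (f : ℝ⟦X⟧) (q s : ℂ) : Prop :=
  Summable (fun n => ‖((coeff n f : ℝ) : ℂ) * q ^ n‖) ∧ HasSum (fun n => ((coeff n f : ℝ) : ℂ) * q ^ n) s

lemma EvalsTo.of_bounded {f : ℝ⟦X⟧} {q : ℂ} {M : ℝ} (hq : ‖q‖ < 1) (hf : ∀ n, |coeff n f| ≤ M) :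
    EvalsTo f q (∑' n, ((coeff n f : ℝ) : ℂ) * q ^ n) := by
  have h : Summable (fun n => ‖((coeff n f : ℝ) : ℂ) * q ^ n‖) := by
    refine Summable.of_nonneg_of_le (fun _ => norm_nonneg _) (fun n => ?_)
      ((summable_geometric_of_lt_one (norm_nonneg q) hq).mul_left M)
    rw [norm_mul, norm_pow, Complex.norm_real, Real.norm_eq_abs]
    gcongr
    exact hf n
  exact ⟨h, h.of_norm.hasSum⟩

lemma EvalsTo.mul {f g : ℝ⟦X⟧} {q s t : ℂ} (hf : EvalsTo f q s) (hg : EvalsTo g q t) :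
    EvalsTo (f * g) q (s * t) := by
  have h : ∀ n, ((coeff n (f * g) : ℝ) : ℂ) * q ^ n = ∑ p ∈ Finset.HasAntidiagonal.antidiagonal n,
      (((coeff p.1 f : ℝ) : ℂ) * q ^ p.1) * (((coeff p.2 g : ℝ) : ℂ) * q ^ p.2) := by
    intro n
    rw [coeff_mul, Complex.ofReal_sum, Finset.sum_mul]
    refine Finset.sum_congr rfl fun p hp => ?_
    rw [← Finset.HasAntidiagonal.mem_antidiagonal.1 hp, pow_add]
    push_cast
    ring
  have hs := summable_norm_sum_mul_antidiagonal_of_summable_norm hf.1 hg.1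
  refine ⟨?_, ?_⟩
  · simp_rw [h]
    exact hs
  · simp_rw [h]
    rw [← hf.2.tsum_eq, ← hg.2.tsum_eq,
      tsum_mul_tsum_eq_tsum_sum_antidiagonal_of_summable_norm hf.1 hg.1]
    exact hs.of_norm.hasSum

lemma EvalsTo.unique {f : ℝ⟦X⟧} {q s t : ℂ} (hf : EvalsTo f q s) (hg : EvalsTo f q t) : s = t :=
  hf.2.unique hg.2

lemma EvalsTo.one (q : ℂ) : EvalsTo 1 q 1 := by
  have h : ∀ n, n ≠ 0 → ((coeff n (1 : ℝ⟦X⟧) : ℝ) : ℂ) * q ^ n = 0 := by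
    intro n hn
    simp [coeff_one, hn]
  refine ⟨summable_of_ne_finset_zero (s := {0}) fun n hn => ?_, ?_⟩
  · rw [h n (by simpa using hn), norm_zero]
  · simpa using hasSum_single 0 h

lemma EvalsTo.X_pow (q : ℂ) (k : ℕ) : EvalsTo (X ^ k) q (q ^ k) := by
  have h : ∀ n, n ≠ k → ((coeff n (X ^ k : ℝ⟦X⟧) : ℝ) : ℂ) * q ^ n = 0 := by
    intro n hn
    simp [coeff_X_pow, hn]
  refine ⟨summable_of_ne_finset_zero (s := {k}) fun n hn => ?_, ?_⟩
  · rw [h n (by simpa using hn), norm_zero]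
  · simpa [coeff_X_pow] using hasSum_single k h

lemma EvalsTo.add {f g : ℝ⟦X⟧} {q s t : ℂ} (hf : EvalsTo f q s) (hg : EvalsTo g q t) :
    EvalsTo (f + g) q (s + t) := by
  refine ⟨?_, ?_⟩
  · refine Summable.of_nonneg_of_le (fun _ => norm_nonneg _) (fun n => ?_) (hf.1.add hg.1)
    rw [map_add, Complex.ofReal_add, add_mul]
    exact norm_add_le _ _
  · simpa [add_mul] using hf.2.add hg.2

lemma EvalsTo.neg {f : ℝ⟦X⟧} {q s : ℂ} (hf : EvalsTo f q s) : EvalsTo (-f) q (-s) := by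
  refine ⟨?_, ?_⟩
  · simpa using hf.1
  · simpa using hf.2.neg

lemma norm_pow_succ_lt_one {q : ℂ} (hq : ‖q‖ < 1) (k : ℕ) : ‖q ^ (k + 1)‖ < 1 := by
  rw [norm_pow]
  exact pow_lt_one₀ (norm_nonneg _) hq (by omega)

lemma one_sub_pow_ne_zero {q : ℂ} (hq : ‖q‖ < 1) (k : ℕ) : 1 - q ^ (k + 1) ≠ 0 := by
  intro h
  have := norm_pow_succ_lt_one hq k
  rw [← sub_eq_zero.1 h] at this
  simp at this

lemma evalsTo_factor {q : ℂ} (hq : ‖q‖ < 1) (k : ℕ) :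
    EvalsTo (factor k) q ((1 + q ^ (k + 1)) / (1 - q ^ (k + 1))) := by
  have h := EvalsTo.of_bounded (f := factor k) (M := 2) hq fun n => by
    simp only [factor, coeff_mk]
    split_ifs <;> norm_num
  have h1 : EvalsTo (1 - X ^ (k + 1)) q (1 - q ^ (k + 1)) := by
    simpa [sub_eq_add_neg] using (EvalsTo.one q).add (EvalsTo.X_pow q (k + 1)).neg
  have h2 := h.mul h1
  rw [factor_mul] at h2
  rw [← (h2.unique ((EvalsTo.one q).add (EvalsTo.X_pow q (k + 1)))),
    mul_div_cancel_right₀ _ (one_sub_pow_ne_zero hq k)]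
  exact h

lemma evalsTo_prod_factor {q : ℂ} (hq : ‖q‖ < 1) (K : ℕ) :
    EvalsTo (∏ k ∈ Finset.range K, factor k) q
      (∏ k ∈ Finset.range K, (1 + q ^ (k + 1)) / (1 - q ^ (k + 1))) := by
  induction K with
  | zero => simpa using EvalsTo.one q
  | succ K ih =>
    rw [Finset.prod_range_succ, Finset.prod_range_succ]
    exact ih.mul (evalsTo_factor hq K)

lemma prod_factor_le {r : ℝ} (h0 : 0 ≤ r) (h1 : r < 1) (K : ℕ) :
    ∏ k ∈ Finset.range K, (1 + r ^ (k + 1)) / (1 - r ^ (k + 1)) ≤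
      Real.exp (2 * r / (1 - r) ^ 2) := by
  have hlt : ∀ k : ℕ, r ^ (k + 1) ≤ r := fun k => by
    rw [pow_succ]
    exact mul_le_of_le_one_left h0 (pow_le_one₀ h0 h1.le)
  have hstep : ∀ k : ℕ, (1 + r ^ (k + 1)) / (1 - r ^ (k + 1)) ≤
      Real.exp (2 * r ^ (k + 1) / (1 - r)) := by
    intro k
    have hpos : 0 < 1 - r ^ (k + 1) := by linarith [hlt k]
    have hk0 : 0 ≤ r ^ (k + 1) := by positivity
    calc (1 + r ^ (k + 1)) / (1 - r ^ (k + 1)) = 2 * r ^ (k + 1) / (1 - r ^ (k + 1)) + 1 := by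
          field_simp
          ring
      _ ≤ 2 * r ^ (k + 1) / (1 - r) + 1 := by
          have : 0 < 1 - r := by linarith
          have := hlt k
          gcongr
      _ ≤ _ := Real.add_one_le_exp _
  calc _ ≤ ∏ k ∈ Finset.range K, Real.exp (2 * r ^ (k + 1) / (1 - r)) := by
        refine Finset.prod_le_prod (fun k _ => ?_) fun k _ => hstep k
        have : 0 < 1 - r ^ (k + 1) := by linarith [hlt k]
        positivity
    _ = Real.exp (2 * r / (1 - r) * ∑ k ∈ Finset.range K, r ^ k) := by
        rw [← Real.exp_sum, Finset.mul_sum]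
        congr 1
        refine Finset.sum_congr rfl fun k _ => ?_
        ring
    _ ≤ _ := by
        have hpos : 0 < 1 - r := by linarith
        have : ∑ k ∈ Finset.range K, r ^ k ≤ 1 / (1 - r) := by
          rw [le_div_iff₀ hpos, geom_sum_mul_neg]
          have : 0 ≤ r ^ K := by positivity
          linarith
        refine Real.exp_le_exp.2 ?_
        calc 2 * r / (1 - r) * ∑ k ∈ Finset.range K, r ^ k ≤ 2 * r / (1 - r) * (1 / (1 - r)) := by
              gcongr
          _ = _ := by field_simp

lemma summable_overpartitionFn_mul_pow {r : ℝ} (h0 : 0 ≤ r) (h1 : r < 1) :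
    Summable fun n => (overpartitionFn n : ℝ) * r ^ n := by
  refine summable_of_sum_range_le (c := Real.exp (2 * r / (1 - r) ^ 2))
    (fun n => by positivity) fun N => ?_
  have hlim : Tendsto (fun K => ∑ n ∈ Finset.range N,
      coeff n (∏ k ∈ Finset.range K, factor k) * r ^ n) atTop
      (𝓝 (∑ n ∈ Finset.range N, (overpartitionFn n : ℝ) * r ^ n)) :=
    tendsto_finsetSum _ fun n _ => (tendsto_coeff_prod_factor n).mul_const _
  refine le_of_tendsto' hlim fun K => ?_
  have hr : ‖(r : ℂ)‖ < 1 := by simpa [abs_of_nonneg h0] using h1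
  have hE := (evalsTo_prod_factor hr K).2
  have hE' : HasSum (fun n => coeff n (∏ k ∈ Finset.range K, factor k) * r ^ n)
      (∏ k ∈ Finset.range K, (1 + r ^ (k + 1)) / (1 - r ^ (k + 1))) := by
    rw [← Complex.hasSum_ofReal]
    push_cast
    exact hE
  refine le_trans (sum_le_hasSum _ (fun n _ => ?_) hE') (prod_factor_le h0 h1 K)
  exact mul_nonneg (coeff_prod_factor_nonneg K n) (by positivity)

/-- The overpartition generating function on the unit disc. -/
noncomputable def genFun (q : ℂ) : ℂ := ∑' n, (overpartitionFn n : ℂ) * q ^ n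

lemma summable_norm_genFun {q : ℂ} (hq : ‖q‖ < 1) :
    Summable fun n => ‖(overpartitionFn n : ℂ) * q ^ n‖ := by
  simpa using summable_overpartitionFn_mul_pow (norm_nonneg q) hq

lemma tendsto_prod_genFun {q : ℂ} (hq : ‖q‖ < 1) :
    Tendsto (fun K => ∏ k ∈ Finset.range K, (1 + q ^ (k + 1)) / (1 - q ^ (k + 1))) atTop
      (𝓝 (genFun q)) := by
  have h : ∀ K, ∏ k ∈ Finset.range K, (1 + q ^ (k + 1)) / (1 - q ^ (k + 1)) =
      ∑' n, ((coeff n (∏ k ∈ Finset.range K, factor k) : ℝ) : ℂ) * q ^ n :=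
    fun K => (evalsTo_prod_factor hq K).2.tsum_eq.symm
  simp_rw [h]
  refine tendsto_tsum_of_dominated_convergence (summable_norm_genFun hq) (fun n => ?_)
    (Eventually.of_forall fun K n => ?_)
  · refine Tendsto.mul_const _ ?_
    exact_mod_cast (Complex.continuous_ofReal.tendsto _).comp (tendsto_coeff_prod_factor n)
  · rw [norm_mul, norm_mul, Complex.norm_real, Real.norm_eq_abs,
      abs_of_nonneg (coeff_prod_factor_nonneg K n), Complex.norm_natCast]
    gcongr
    exact coeff_prod_factor_le K n

lemma evalsTo_series {q : ℂ} (hq : ‖q‖ < 1) : EvalsTo series q (genFun q) := by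
  have h := summable_norm_genFun hq
  refine ⟨?_, ?_⟩
  · simpa [series] using h
  · simpa [series, genFun] using h.of_norm.hasSum

lemma evalsTo_thetaSeries {q : ℂ} (hq : ‖q‖ < 1) :
    EvalsTo thetaSeries q (∑' n : ℤ, (-1) ^ n * q ^ (n.natAbs ^ 2)) := by
  have h := EvalsTo.of_bounded (f := thetaSeries) (M := 2) hq fun n => by
    simp only [thetaSeries, coeff_mk]
    split_ifs <;> simp [abs_mul]
  have hinj : Function.Injective fun j : ℕ => j ^ 2 := Nat.pow_left_injective (by norm_num)
  have h2 := (hinj.hasSum_iff (f := fun n => ((coeff n thetaSeries : ℝ) : ℂ) * q ^ n) (by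
    intro n hn
    have h1 : n ≠ 0 := by rintro rfl; exact hn ⟨0, rfl⟩
    have h2 : ¬ IsSquare n := by rintro ⟨m, rfl⟩; exact hn ⟨m, by ring⟩
    simp [thetaSeries, h1, h2])).2 h.2
  have hev : ∀ m : ℕ, (-1 : ℂ) ^ (m ^ 2) = (-1) ^ m := by
    intro m
    rcases Nat.even_or_odd m with h | h
    · rw [h.neg_one_pow, (h.pow_of_ne_zero two_ne_zero).neg_one_pow]
    · rw [h.neg_one_pow, h.pow.neg_one_pow]
  set g : ℤ → ℂ := fun n => (-1) ^ n * q ^ (n.natAbs ^ 2) with hg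
  have hsucc : ∀ j : ℕ, ((coeff ((j + 1) ^ 2) thetaSeries : ℝ) : ℂ) * q ^ ((j + 1) ^ 2) =
      g (j + 1 : ℕ) + g (-(j + 1 : ℕ)) := by
    intro j
    have h1 : IsSquare ((j + 1) ^ 2) := ⟨j + 1, by ring⟩
    simp only [thetaSeries, coeff_mk, hg, Int.natAbs_neg, Int.natAbs_natCast, zpow_neg, zpow_natCast,
      h1, if_true, if_neg (show ¬ (j + 1) ^ 2 = 0 by positivity)]
    push_cast
    rw [hev, ← inv_pow, inv_neg_one]
    ring
  have hsum : Summable g := by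
    have h0 : Summable fun j : ℕ => (-1 : ℂ) ^ j * q ^ (j ^ 2) := by
      refine Summable.of_norm_bounded (summable_geometric_of_lt_one (norm_nonneg q) hq) fun j => ?_
      rw [norm_mul, norm_pow, norm_pow, norm_neg, norm_one, one_pow, one_mul]
      exact pow_le_pow_of_le_one (norm_nonneg q) hq.le (Nat.le_self_pow two_ne_zero j)
    refine Summable.of_nat_of_neg (by simpa [hg] using h0) ?_
    refine h0.congr fun j => ?_
    simp only [hg, Int.natAbs_neg, Int.natAbs_natCast, zpow_neg, zpow_natCast]
    rw [← inv_pow, inv_neg_one]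
  have h3 : ∑' n, ((coeff n thetaSeries : ℝ) : ℂ) * q ^ n = ∑' n, g n := by
    rw [← h.2.tsum_eq, ← h2.tsum_eq, h2.summable.tsum_eq_zero_add]
    have hN : Summable fun j : ℕ => g (j + 1 : ℕ) :=
      hsum.comp_injective (i := fun j : ℕ => ((j + 1 : ℕ) : ℤ)) fun a b h => by
        simpa using h
    have hN' : Summable fun j : ℕ => g (-(j + 1 : ℕ)) :=
      hsum.comp_injective (i := fun j : ℕ => -((j + 1 : ℕ) : ℤ)) fun a b h => by
        simpa using h
    simp only [Function.comp_def, hsucc]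
    rw [hN.tsum_add hN', ← add_assoc]
    have hN0 : Summable fun j : ℕ => g j := hsum.comp_injective Nat.cast_injective
    rw [tsum_of_nat_of_neg_add_one hN0 (by exact_mod_cast hN'), hN0.tsum_eq_zero_add]
    simp [thetaSeries, hg]
  rw [← h3]
  exact h

/-- The Gauss identity on the unit disc. -/
lemma genFun_mul_theta {q : ℂ} (hq : ‖q‖ < 1) :
    genFun q * ∑' n : ℤ, (-1) ^ n * q ^ (n.natAbs ^ 2) = 1 := by
  have h := (evalsTo_series hq).mul (evalsTo_thetaSeries hq)
  rw [series_mul_thetaSeries] at h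
  exact h.unique (EvalsTo.one q)

end Evaluation

section Theta

/-- The leading term of the overpartition generating function at `exp (-t)` near `t = 0`. -/
noncomputable def mainTerm (t : ℂ) : ℂ :=
  (t / Real.pi) ^ (1 / 2 : ℂ) / 2 * Complex.exp (Real.pi ^ 2 / (4 * t))

/-- The relative correction to `mainTerm`. -/
noncomputable def thetaTail (t : ℂ) : ℂ :=
  ∑' k : ℕ, Complex.exp (-Real.pi ^ 2 / t * ((k + 1) * (k + 2)))

lemma norm_exp_thetaTail_le {t : ℂ} (ht : 0 < t.re) (k : ℕ) :
    ‖Complex.exp (-Real.pi ^ 2 / t * (k * (k + 1)))‖ ≤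
      Real.exp (-2 * Real.pi ^ 2 * (1 / t).re) ^ k := by
  have hR : 0 < (1 / t).re := by
    rw [one_div, Complex.inv_re]
    have : 0 < Complex.normSq t := Complex.normSq_pos.2 (by rintro rfl; simp at ht)
    positivity
  have h1 : -(Real.pi : ℂ) ^ 2 / t * (k * (k + 1)) =
      ((-Real.pi ^ 2 * (k * (k + 1)) : ℝ) : ℂ) * (1 / t) := by
    push_cast
    ring
  rw [Complex.norm_exp, ← Real.exp_nat_mul, h1, Complex.re_ofReal_mul]
  refine Real.exp_le_exp.2 ?_
  have h2 : (k : ℝ) ≤ k * k := by exact_mod_cast Nat.le_mul_self k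
  have h3 : 0 ≤ Real.pi ^ 2 * (1 / t).re := by positivity
  nlinarith

lemma exp_re_lt_one {t : ℂ} (ht : 0 < t.re) : Real.exp (-2 * Real.pi ^ 2 * (1 / t).re) < 1 := by
  have hR : 0 < (1 / t).re := by
    rw [one_div, Complex.inv_re]
    have : 0 < Complex.normSq t := Complex.normSq_pos.2 (by rintro rfl; simp at ht)
    positivity
  have : 0 < Real.pi ^ 2 * (1 / t).re := by positivity
  rw [Real.exp_lt_one_iff]
  linarith

lemma summable_thetaTail {t : ℂ} (ht : 0 < t.re) :
    Summable fun k : ℕ => Complex.exp (-Real.pi ^ 2 / t * (k * (k + 1))) :=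
  Summable.of_norm_bounded (summable_geometric_of_lt_one (Real.exp_nonneg _) (exp_re_lt_one ht))
    (norm_exp_thetaTail_le ht)

lemma norm_exp_neg_lt_one {t : ℂ} (ht : 0 < t.re) : ‖Complex.exp (-t)‖ < 1 := by
  rw [Complex.norm_exp, Complex.neg_re, Real.exp_lt_one_iff]
  linarith

lemma genFun_mul_one_add_thetaTail {t : ℂ} (ht : 0 < t.re) :
    genFun (Complex.exp (-t)) * (1 + thetaTail t) = mainTerm t := by
  have hpi : (Real.pi : ℂ) ≠ 0 := by exact_mod_cast Real.pi_ne_zero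
  have ht0 : t ≠ 0 := by rintro rfl; simp at ht
  have ha : 0 < (t / Real.pi).re := by
    rw [Complex.div_ofReal_re]
    have := Real.pi_pos
    positivity
  have hg := genFun_mul_theta (norm_exp_neg_lt_one ht)
  have h1 : ∑' n : ℤ, (-1 : ℂ) ^ n * Complex.exp (-t) ^ (n.natAbs ^ 2) =
      ∑' n : ℤ, Complex.exp (-Real.pi * (t / Real.pi) * n ^ 2 +
        2 * Real.pi * (-Complex.I / 2) * n) := by
    refine tsum_congr fun n => ?_
    rw [Complex.exp_add, mul_comm]
    congr 1
    · rw [← Complex.exp_nat_mul]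
      congr 1
      have : ((n.natAbs ^ 2 : ℕ) : ℂ) = (n : ℂ) ^ 2 := by
        have : ((n.natAbs ^ 2 : ℕ) : ℤ) = n ^ 2 := by simp
        rw [← Int.cast_natCast, this, Int.cast_pow]
      rw [this]
      field_simp
    · have : (2 * Real.pi * (-Complex.I / 2) * n : ℂ) = ((-n : ℤ) : ℂ) * (Real.pi * Complex.I) := by
        push_cast
        ring
      rw [this, Complex.exp_int_mul, Complex.exp_pi_mul_I, zpow_neg, ← inv_zpow, inv_neg_one]
  have hS := summable_thetaTail ht
  have h2 : ∑' n : ℤ, Complex.exp (-Real.pi / (t / Real.pi) *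
      (n + Complex.I * (-Complex.I / 2)) ^ 2) =
      Complex.exp (-(Real.pi ^ 2 / (4 * t))) * (2 * (1 + thetaTail t)) := by
    have h3 : ∀ n : ℤ, Complex.exp (-Real.pi / (t / Real.pi) *
        (n + Complex.I * (-Complex.I / 2)) ^ 2) =
        Complex.exp (-(Real.pi ^ 2 / (4 * t))) *
          Complex.exp (-Real.pi ^ 2 / t * (n * (n + 1))) := by
      intro n
      rw [← Complex.exp_add]
      congr 1
      have : Complex.I * (-Complex.I / 2) = 1 / 2 := by
        linear_combination (-1 / 2 : ℂ) * Complex.I_mul_I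
      rw [this]
      field_simp
      ring
    simp_rw [h3]
    rw [tsum_mul_left]
    congr 1
    have h4 : ∀ k : ℕ, Complex.exp (-Real.pi ^ 2 / t *
        (((-((k : ℤ) + 1) : ℤ) : ℂ) * (((-((k : ℤ) + 1) : ℤ) : ℂ) + 1))) =
        Complex.exp (-Real.pi ^ 2 / t * (k * (k + 1))) := by
      intro k
      congr 2
      push_cast
      ring
    rw [tsum_of_nat_of_neg_add_one (by simpa using hS) (by simpa only [h4] using hS)]
    simp_rw [h4]
    simp only [Int.cast_natCast]
    rw [hS.tsum_eq_zero_add, thetaTail]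
    push_cast
    simp only [zero_mul, mul_zero, Complex.exp_zero, add_assoc, one_add_one_eq_two]
    ring
  rw [h1, Complex.tsum_exp_neg_quadratic ha, h2, Complex.exp_neg (_ / _)] at hg
  have hc : (t / Real.pi) ^ (1 / 2 : ℂ) ≠ 0 := by
    rw [Complex.cpow_ne_zero_iff]
    exact Or.inl (div_ne_zero ht0 hpi)
  have he := Complex.exp_ne_zero (Real.pi ^ 2 / (4 * t))
  rw [mainTerm]
  set G := genFun (Complex.exp (-t))
  set E := Complex.exp (Real.pi ^ 2 / (4 * t))
  set c := (t / Real.pi) ^ (1 / 2 : ℂ)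
  have h5 : c * E * (G * (1 / c * (E⁻¹ * (2 * (1 + thetaTail t))))) = c * E := by rw [hg, mul_one]
  have h6 : c * E * (G * (1 / c * (E⁻¹ * (2 * (1 + thetaTail t))))) =
      2 * G * (1 + thetaTail t) := by
    rw [one_div]
    linear_combination (2 * G * (1 + thetaTail t) * E * E⁻¹) * mul_inv_cancel₀ hc +
      (2 * G * (1 + thetaTail t)) * mul_inv_cancel₀ he
  linear_combination (h6.symm.trans h5) / 2

lemma norm_thetaTail_le {t : ℂ} (ht : 0 < t.re) :
    ‖thetaTail t‖ ≤ Real.exp (-2 * Real.pi ^ 2 * (1 / t).re) /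
      (1 - Real.exp (-2 * Real.pi ^ 2 * (1 / t).re)) := by
  set x := Real.exp (-2 * Real.pi ^ 2 * (1 / t).re) with hx
  have h := (hasSum_geometric_of_lt_one (Real.exp_nonneg _) (exp_re_lt_one ht)).mul_left x
  rw [← hx, ← div_eq_mul_inv] at h
  refine tsum_of_norm_bounded h fun k => ?_
  have := norm_exp_thetaTail_le ht (k + 1)
  rw [pow_succ' (Real.exp _)] at this
  push_cast at this
  rw [add_assoc (k : ℂ) 1 1, one_add_one_eq_two] at this
  exact this

lemma norm_genFun_le_norm_mainTerm {s : ℝ} (hs : 0 < s) :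
    ‖genFun (Complex.exp (-s))‖ ≤ ‖mainTerm s‖ := by
  rw [← genFun_mul_one_add_thetaTail (t := (s : ℂ)) (by simpa using hs), norm_mul]
  refine le_mul_of_one_le_right (norm_nonneg _) ?_
  have h : thetaTail s = ((∑' k : ℕ, Real.exp (-Real.pi ^ 2 / s * ((k + 1) * (k + 2))) : ℝ) : ℂ) := by
    rw [thetaTail, Complex.ofReal_tsum]
    push_cast
    rfl
  have h0 : 0 ≤ ∑' k : ℕ, Real.exp (-Real.pi ^ 2 / s * ((k + 1) * (k + 2))) :=
    tsum_nonneg fun _ => Real.exp_nonneg _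
  rw [h]
  calc (1 : ℝ) ≤ |1 + ∑' k : ℕ, Real.exp (-Real.pi ^ 2 / s * ((k + 1) * (k + 2)))| := by
        rw [abs_of_nonneg (by linarith)]
        linarith
    _ = _ := by
        rw [← Real.norm_eq_abs, ← Complex.norm_real]
        push_cast
        rfl

lemma norm_mainTerm (t : ℂ) :
    ‖mainTerm t‖ = √(‖t‖ / Real.pi) / 2 * Real.exp (Real.pi ^ 2 / 4 * (1 / t).re) := by
  rw [mainTerm, norm_mul, norm_div, Complex.norm_exp]
  have h1 : (Real.pi : ℂ) ^ 2 / (4 * t) = ((Real.pi ^ 2 / 4 : ℝ) : ℂ) * (1 / t) := by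
    push_cast
    field_simp
  have h2 : (1 / 2 : ℂ) = ((1 / 2 : ℝ) : ℂ) := by push_cast; rfl
  rw [h1, Complex.re_ofReal_mul, h2, Complex.norm_cpow_real, ← Real.sqrt_eq_rpow, norm_div,
    Complex.norm_real, Real.norm_of_nonneg Real.pi_pos.le]
  simp

lemma norm_genFun_sub_mainTerm_le {t : ℂ} (ht : 1 / 2 ≤ (1 / t).re) (ht' : ‖t‖ ≤ Real.pi) :
    ‖genFun (Complex.exp (-t)) - mainTerm t‖ ≤ 1 := by
  have h0 : 0 < t.re := by
    have : 0 < (1 / t).re := by linarith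
    rw [one_div, Complex.inv_re] at this
    by_contra h
    exact absurd this (not_lt.2 (div_nonpos_of_nonpos_of_nonneg (not_lt.1 h)
      (Complex.normSq_nonneg t)))
  set R := (1 / t).re with hR
  have hF := genFun_mul_one_add_thetaTail h0
  have hη := norm_thetaTail_le h0
  rw [← hR] at hη
  set x := Real.exp (-2 * Real.pi ^ 2 * R) with hx
  have hpi : 9 < Real.pi ^ 2 := by nlinarith [Real.pi_gt_three]
  have hx4 : x ≤ 1 / 4 := by
    have : Real.exp (2 * Real.pi ^ 2 * R) ≥ 4 := by
      have := Real.add_one_le_exp (2 * Real.pi ^ 2 * R)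
      nlinarith
    rw [hx, neg_mul, neg_mul, Real.exp_neg, ← one_div]
    gcongr
  have hx0 : 0 < x := Real.exp_pos _
  have hη' : ‖thetaTail t‖ ≤ 4 / 3 * x := by
    refine hη.trans ?_
    rw [div_le_iff₀ (by linarith)]
    nlinarith
  have h1 : 1 - ‖thetaTail t‖ ≤ ‖1 + thetaTail t‖ := by
    have := norm_sub_norm_le (1 : ℂ) (-thetaTail t)
    simpa using this
  have h2 : ‖genFun (Complex.exp (-t))‖ * (2 / 3) ≤ ‖mainTerm t‖ := by
    rw [← hF, norm_mul]
    gcongr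
    linarith
  have h3 : genFun (Complex.exp (-t)) - mainTerm t = -(genFun (Complex.exp (-t)) * thetaTail t) := by
    rw [← hF]
    ring
  rw [h3, norm_neg, norm_mul]
  have h4 : ‖mainTerm t‖ ≤ 1 / 2 * Real.exp (Real.pi ^ 2 / 4 * R) := by
    rw [norm_mainTerm]
    gcongr
    rw [Real.sqrt_le_one]
    exact div_le_one_of_le₀ ht' Real.pi_pos.le
  calc _ ≤ (3 / 2 * ‖mainTerm t‖) * (4 / 3 * x) := by
        gcongr
        linarith
    _ ≤ (3 / 2 * (1 / 2 * Real.exp (Real.pi ^ 2 / 4 * R))) * (4 / 3 * x) := by gcongr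
    _ = Real.exp (Real.pi ^ 2 / 4 * R + -2 * Real.pi ^ 2 * R) := by
        rw [Real.exp_add, ← hx]
        ring
    _ ≤ 1 := by
        rw [Real.exp_le_one_iff]
        nlinarith

end Theta

section MinorArc

lemma hasSum_neg_log_add_log {x : ℂ} (hx : ‖x‖ < 1) :
    HasSum (fun n : ℕ => x ^ n / n - (-x) ^ n / n) (-Complex.log (1 - x) + Complex.log (1 + x)) := by
  have h1 := Complex.hasSum_taylorSeries_neg_log hx
  have h2 := Complex.hasSum_taylorSeries_neg_log (z := -x) (by simpa using hx)
  simpa using h1.sub h2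

lemma exp_re_neg_log_add_log {x : ℂ} (hx : ‖x‖ < 1) :
    Real.exp (-Complex.log (1 - x) + Complex.log (1 + x)).re = ‖(1 + x) / (1 - x)‖ := by
  have h1 : 1 - x ≠ 0 := by
    intro h
    rw [← sub_eq_zero.1 h] at hx
    simp at hx
  have h2 : 1 + x ≠ 0 := by
    intro h
    rw [← neg_eq_of_add_eq_zero_right h] at hx
    simp at hx
  rw [← Complex.norm_exp, Complex.exp_add, Complex.exp_neg, Complex.exp_log h1, Complex.exp_log h2,
    mul_comm, div_eq_mul_inv]

lemma norm_factor_le {x : ℂ} (hx : ‖x‖ < 1) :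
    ‖(1 + x) / (1 - x)‖ ≤ (1 + ‖x‖) / (1 - ‖x‖) * Real.exp (-2 * (‖x‖ - x.re)) := by
  have hx' : ‖((‖x‖ : ℝ) : ℂ)‖ < 1 := by simpa using hx
  have h1 := Complex.hasSum_re (hasSum_neg_log_add_log hx)
  have h2 := Complex.hasSum_re (hasSum_neg_log_add_log hx')
  have h3 : (1 + ‖x‖) / (1 - ‖x‖) = ‖(1 + ((‖x‖ : ℝ) : ℂ)) / (1 - ((‖x‖ : ℝ) : ℂ))‖ := by
    rw [norm_div]
    congr 1
    · rw [← Complex.ofReal_one, ← Complex.ofReal_add, Complex.norm_real, Real.norm_of_nonneg]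
      positivity
    · rw [← Complex.ofReal_one, ← Complex.ofReal_sub, Complex.norm_real, Real.norm_of_nonneg]
      linarith
  rw [h3, ← exp_re_neg_log_add_log hx, ← exp_re_neg_log_add_log hx', ← Real.exp_add]
  refine Real.exp_le_exp.2 ?_
  have h4 := h1.sub (hasSum_ite_eq 1 (2 * x.re))
  have h5 := h2.sub (hasSum_ite_eq 1 (2 * ‖x‖))
  have h6 := hasSum_le (fun n => ?_) h4 h5
  · linarith
  by_cases hn : n = 1
  · subst hn
    simp
    linarith
  rw [if_neg hn, if_neg hn, sub_zero, sub_zero]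
  rcases Nat.even_or_odd n with h | h
  · rw [h.neg_pow, sub_self, h.neg_pow, sub_self]
  · rw [h.neg_pow, h.neg_pow, neg_div, sub_neg_eq_add, neg_div, sub_neg_eq_add]
    have h7 : ∀ y : ℂ, (y ^ n / n + y ^ n / n).re = 2 / n * (y ^ n).re := by
      intro y
      have : y ^ n / n + y ^ n / n = ((2 / n : ℝ) : ℂ) * y ^ n := by
        push_cast
        ring
      rw [this, Complex.re_ofReal_mul]
    rw [h7, h7, ← Complex.ofReal_pow, Complex.ofReal_re]
    refine mul_le_mul_of_nonneg_left ?_ (by positivity)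
    exact (Complex.re_le_norm _).trans_eq (norm_pow _ _)

lemma norm_genFun_le {q : ℂ} (hq : ‖q‖ < 1) :
    ‖genFun q‖ ≤ ‖genFun ‖q‖‖ * Real.exp (-2 * (‖q‖ / (1 - ‖q‖) - (q / (1 - q)).re)) := by
  have hr : ‖((‖q‖ : ℝ) : ℂ)‖ < 1 := by simpa using hq
  have h1 := (tendsto_prod_genFun hq).norm
  have h2 := (tendsto_prod_genFun hr).norm
  have h3 : HasSum (fun k : ℕ => q ^ (k + 1)) (q / (1 - q)) := by
    have := (hasSum_geometric_of_norm_lt_one hq).mul_left q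
    simpa only [pow_succ', div_eq_mul_inv] using this
  have h4 : HasSum (fun k : ℕ => ‖q‖ ^ (k + 1)) (‖q‖ / (1 - ‖q‖)) := by
    have := (hasSum_geometric_of_lt_one (norm_nonneg q) hq).mul_left ‖q‖
    simpa only [pow_succ', div_eq_mul_inv] using this
  have h5 := ((h4.sub (Complex.hasSum_re h3)).tendsto_sum_nat.const_mul (-2)).rexp
  refine le_of_tendsto_of_tendsto' h1 (h2.mul h5) fun K => ?_
  rw [norm_prod, norm_prod, Finset.mul_sum, Real.exp_sum, ← Finset.prod_mul_distrib]
  refine Finset.prod_le_prod (fun _ _ => norm_nonneg _) fun k _ => ?_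
  have hk := norm_pow_succ_lt_one hq k
  refine (norm_factor_le hk).trans_eq ?_
  rw [norm_pow]
  congr 1
  have h6 := norm_pow_succ_lt_one hr k
  rw [← Complex.ofReal_pow, ← Complex.ofReal_one, ← Complex.ofReal_add, ← Complex.ofReal_sub,
    ← Complex.ofReal_div, Complex.norm_real, Real.norm_of_nonneg]
  have : 0 < 1 - ‖q‖ ^ (k + 1) := by
    rw [norm_pow] at hk
    linarith
  positivity

lemma two_mul_gap_eq {q : ℂ} (hq : ‖q‖ < 1) :
    2 * (‖q‖ / (1 - ‖q‖) - (q / (1 - q)).re) =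
      (1 + ‖q‖) / (1 - ‖q‖) * (1 - (1 - ‖q‖) ^ 2 / ((1 - ‖q‖) ^ 2 + 2 * (‖q‖ - q.re))) := by
  have h1 : 1 - q ≠ 0 := by simpa using one_sub_pow_ne_zero hq 0
  have h2 : Complex.normSq (1 - q) = (1 - ‖q‖) ^ 2 + 2 * (‖q‖ - q.re) := by
    have h3 : ‖q‖ ^ 2 = q.re ^ 2 + q.im ^ 2 := by
      rw [← Complex.normSq_eq_norm_sq, Complex.normSq_apply]
      ring
    rw [Complex.normSq_apply]
    simp only [Complex.sub_re, Complex.one_re, Complex.sub_im, Complex.one_im]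
    linarith
  have hD : 0 < Complex.normSq (1 - q) := Complex.normSq_pos.2 h1
  have h4 : q / (1 - q) = (1 - q)⁻¹ - 1 := by
    field_simp
    ring
  rw [h4, Complex.sub_re, Complex.inv_re, Complex.one_re, Complex.sub_re, Complex.one_re]
  rw [← h2]
  have hr : 0 < 1 - ‖q‖ := by linarith
  have h5 : q.re = ((1 - ‖q‖) ^ 2 + 2 * ‖q‖ - Complex.normSq (1 - q)) / 2 := by
    rw [h2]
    ring
  rw [h5]
  field_simp
  ring

lemma exp_neg_lower {s : ℝ} (h0 : 0 ≤ s) (h1 : s ≤ 1) :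
    1 - s + s ^ 2 / 2 - s ^ 3 / 6 - s ^ 4 * (5 / 96) ≤ Real.exp (-s) := by
  have h := Real.exp_bound (x := -s) (by rwa [abs_neg, abs_of_nonneg h0]) (n := 4) (by norm_num)
  rw [abs_neg, abs_of_nonneg h0, abs_le] at h
  have := h.1
  norm_num [Finset.sum_range_succ, Nat.factorial] at this
  linarith

lemma norm_genFun_minor_le {s y : ℝ} (hs : 0 < s) (hs1 : s ≤ 3 / 50) (hy : 2 * s ≤ |y|)
    (hy' : |y| ≤ Real.pi) :
    ‖genFun (Complex.exp (-(s + y * Complex.I)))‖ ≤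
      ‖mainTerm s‖ * Real.exp (-(Real.pi / (2 * s))) := by
  set q := Complex.exp (-(s + y * Complex.I)) with hq
  set r := Real.exp (-s) with hr
  have hnorm : ‖q‖ = r := by
    rw [hq, Complex.norm_exp]
    simp [hr]
  have hre : q.re = r * Real.cos y := by
    rw [hq, Complex.exp_re]
    simp [hr]
  have hr1 : r < 1 := by rw [hr, Real.exp_lt_one_iff]; linarith
  have hr0 : 0 < r := Real.exp_pos _
  have hlow := exp_neg_lower hs.le (by linarith)
  rw [← hr] at hlow
  have hr2 : 1 - s ≤ r := Real.one_sub_le_exp_neg s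
  have hcos : Real.cos y ≤ 1 - 2 * Real.sin s ^ 2 := by
    have h1 : 1 - 2 * Real.sin s ^ 2 = Real.cos (2 * s) := by
      rw [Real.cos_two_mul, Real.cos_sq']
      ring
    rw [← Real.cos_abs y, h1]
    exact Real.cos_le_cos_of_nonneg_of_le_pi (by linarith) hy' hy
  have hsin : s - s ^ 3 / 6 ≤ Real.sin s := (Real.sin_gt_sub_cube hs).le
  have hsin2 : (0.998 * s) ^ 2 ≤ Real.sin s ^ 2 := by
    have : 0.998 * s ≤ s - s ^ 3 / 6 := by nlinarith
    gcongr
    linarith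
  have hκ : 3.7 * (1 - r) ^ 2 ≤ 2 * (r - q.re) := by
    have h1 : 2 * (r - q.re) ≥ 4 * (r * Real.sin s ^ 2) := by
      rw [hre]
      nlinarith
    have h2 : r * Real.sin s ^ 2 ≥ 0.94 * (0.998 * s) ^ 2 := by
      have : 0.94 ≤ r := by linarith
      gcongr
    have h3 : (1 - r) ^ 2 ≤ s ^ 2 := by
      have : 0 ≤ 1 - r := by linarith
      gcongr
      linarith
    nlinarith
  have hq1 : ‖q‖ < 1 := by rwa [hnorm]
  have hmain := norm_genFun_le hq1
  have h2 := two_mul_gap_eq hq1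
  rw [hnorm] at hmain h2
  have hcoth : 2 / s ≤ (1 + r) / (1 - r) := by
    rw [div_le_div_iff₀ hs (by linarith)]
    nlinarith [pow_pos hs 2, pow_pos hs 3, pow_pos hs 4]
  have hfrac : Real.pi / 4 ≤ 1 - (1 - r) ^ 2 / ((1 - r) ^ 2 + 2 * (r - q.re)) := by
    have h3 : 0 < (1 - r) ^ 2 := by
      have : 0 < 1 - r := by linarith
      positivity
    have h4 : (1 - r) ^ 2 / ((1 - r) ^ 2 + 2 * (r - q.re)) ≤ 1 / 4.7 := by
      rw [div_le_div_iff₀ (by nlinarith) (by norm_num)]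
      linarith
    have := Real.pi_lt_d4
    norm_num at h4
    linarith
  have hgap : Real.pi / (2 * s) ≤ 2 * (r / (1 - r) - (q / (1 - q)).re) := by
    rw [h2]
    calc Real.pi / (2 * s) = 2 / s * (Real.pi / 4) := by
          field_simp
          norm_num
      _ ≤ _ := by
          have := Real.pi_pos
          gcongr
  have hbase : ‖genFun r‖ ≤ ‖mainTerm s‖ := by
    rw [hr]
    have := norm_genFun_le_norm_mainTerm hs
    push_cast
    exact this
  refine hmain.trans ?_
  gcongr
  linarith

end MinorArc

section Cauchy

lemma integral_exp_int_mul {k : ℤ} (hk : k ≠ 0) (s : ℝ) :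
    ∫ y in (-Real.pi)..Real.pi, Complex.exp (k * (s + y * Complex.I)) = 0 := by
  have h1 : ∀ y : ℝ, Complex.exp (k * (s + y * Complex.I)) =
      Complex.exp (k * s) * Complex.exp ((k * Complex.I) * y) := by
    intro y
    rw [← Complex.exp_add]
    congr 1
    ring
  have hk' : (k : ℂ) * Complex.I ≠ 0 := mul_ne_zero (by exact_mod_cast hk) Complex.I_ne_zero
  simp_rw [h1]
  rw [intervalIntegral.integral_const_mul, integral_exp_mul_complex hk']
  have h2 : Complex.exp ((k * Complex.I) * (Real.pi : ℝ)) =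
      Complex.exp ((k * Complex.I) * ((-Real.pi : ℝ) : ℂ)) := by
    rw [Complex.exp_eq_exp_iff_exists_int]
    refine ⟨k, ?_⟩
    push_cast
    ring
  rw [h2, sub_self, zero_div, mul_zero]

lemma norm_exp_neg_add_mul_I_lt_one {s : ℝ} (hs : 0 < s) (y : ℝ) :
    ‖Complex.exp (-(s + y * Complex.I))‖ < 1 :=
  norm_exp_neg_lt_one (by simpa using hs)

lemma continuous_genFun_exp {s : ℝ} (hs : 0 < s) :
    Continuous fun y : ℝ => genFun (Complex.exp (-(s + y * Complex.I))) := by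
  have hr : Real.exp (-s) < 1 := by rw [Real.exp_lt_one_iff]; linarith
  refine continuous_tsum (fun m => by fun_prop)
    (summable_overpartitionFn_mul_pow (Real.exp_nonneg _) hr) fun m y => ?_
  rw [norm_mul, norm_pow, Complex.norm_natCast, Complex.norm_exp]
  simp

lemma two_pi_mul_overpartitionFn (n : ℕ) {s : ℝ} (hs : 0 < s) :
    ∫ y in (-Real.pi)..Real.pi,
      genFun (Complex.exp (-(s + y * Complex.I))) * Complex.exp (n * (s + y * Complex.I)) =
    2 * Real.pi * overpartitionFn n := by
  have hr : Real.exp (-s) < 1 := by rw [Real.exp_lt_one_iff]; linarith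
  set F : ℕ → ℝ → ℂ := fun m y => overpartitionFn m * Complex.exp (-(s + y * Complex.I)) ^ m *
    Complex.exp (n * (s + y * Complex.I)) with hF
  have hbound : Summable fun m =>
      (overpartitionFn m : ℝ) * Real.exp (-s) ^ m * Real.exp (n * s) :=
    (summable_overpartitionFn_mul_pow (Real.exp_nonneg _) hr).mul_right _
  have h := intervalIntegral.hasSum_integral_of_dominated_convergence (μ := MeasureTheory.volume)
    (a := -Real.pi) (b := Real.pi) (F := F)
    (f := fun y => genFun (Complex.exp (-(s + y * Complex.I))) *
      Complex.exp (n * (s + y * Complex.I)))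
    (fun m _ => (overpartitionFn m : ℝ) * Real.exp (-s) ^ m * Real.exp (n * s))
    (fun m => Continuous.aestronglyMeasurable (by fun_prop))
    (fun m => Eventually.of_forall fun y _ => by
      simp only [hF]
      rw [norm_mul, norm_mul, norm_pow, Complex.norm_natCast, Complex.norm_exp, Complex.norm_exp]
      simp)
    (Eventually.of_forall fun y _ => hbound) intervalIntegrable_const
    (Eventually.of_forall fun y _ =>
      (summable_norm_genFun (norm_exp_neg_add_mul_I_lt_one hs y)).of_norm.hasSum.mul_right _)
  have hF' : ∀ m y, F m y = overpartitionFn m *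
      Complex.exp (((n - m : ℤ) : ℂ) * (s + y * Complex.I)) := by
    intro m y
    simp only [hF]
    rw [mul_assoc, ← Complex.exp_nat_mul, ← Complex.exp_add]
    congr 2
    push_cast
    ring
  simp_rw [hF', intervalIntegral.integral_const_mul] at h
  refine h.unique ?_
  have h3 := hasSum_single (f := fun m : ℕ => (overpartitionFn m : ℂ) *
    ∫ y in (-Real.pi)..Real.pi, Complex.exp (((n - m : ℤ) : ℂ) * (s + y * Complex.I))) n
    fun m hm => by
      rw [integral_exp_int_mul (by omega), mul_zero]
  have h4 : (overpartitionFn n : ℂ) * ∫ y in (-Real.pi)..Real.pi,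
      Complex.exp (((n - n : ℤ) : ℂ) * (s + y * Complex.I)) =
      2 * Real.pi * overpartitionFn n := by
    simp
    ring
  rw [h4] at h3
  exact h3

/-- The integral over the major arc. -/
noncomputable def majorIntegral (n : ℕ) (s : ℝ) : ℂ :=
  ∫ y in (-(2 * s))..(2 * s), mainTerm (s + y * Complex.I) * Complex.exp (n * (s + y * Complex.I))

lemma continuousOn_mainTerm {s : ℝ} (hs : 0 < s) :
    Continuous fun y : ℝ => mainTerm (s + y * Complex.I) := by
  unfold mainTerm
  have hpi := Real.pi_pos
  refine Continuous.mul (Continuous.div_const (Continuous.cpow (by fun_prop) (by fun_prop)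
    fun y => Or.inl ?_) _) (Complex.continuous_exp.comp (Continuous.div₀ (by fun_prop)
      (by fun_prop) fun y h => ?_))
  · rw [Complex.div_ofReal_re]
    simp only [Complex.add_re, Complex.ofReal_re, Complex.mul_re, Complex.ofReal_im, Complex.I_re,
      Complex.I_im, mul_zero, zero_mul, sub_zero, add_zero]
    positivity
  · have := congrArg Complex.re h
    simp at this
    linarith

lemma norm_minor_integrand_le {s : ℝ} (hs : 0 < s) (hs1 : s ≤ 3 / 50) (n : ℕ) {y : ℝ}
    (hy : 2 * s ≤ |y|) (hy' : |y| ≤ Real.pi) :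
    ‖genFun (Complex.exp (-(s + y * Complex.I))) * Complex.exp (n * (s + y * Complex.I))‖ ≤
      ‖mainTerm s‖ * Real.exp (-(Real.pi / (2 * s))) * Real.exp (n * s) := by
  rw [norm_mul, Complex.norm_exp (n * _)]
  have : ((n : ℂ) * (s + y * Complex.I)).re = n * s := by simp
  rw [this]
  gcongr
  exact norm_genFun_minor_le hs hs1 hy hy'

lemma norm_major_integrand_le {s : ℝ} (hs : 0 < s) (hs1 : s ≤ 3 / 50) (n : ℕ) {y : ℝ}
    (hy : |y| ≤ 2 * s) :
    ‖(genFun (Complex.exp (-(s + y * Complex.I))) - mainTerm (s + y * Complex.I)) *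
      Complex.exp (n * (s + y * Complex.I))‖ ≤ Real.exp (n * s) := by
  rw [norm_mul, Complex.norm_exp (n * _)]
  have : ((n : ℂ) * (s + y * Complex.I)).re = n * s := by simp
  rw [this]
  refine mul_le_of_le_one_left (Real.exp_nonneg _) (norm_genFun_sub_mainTerm_le ?_ ?_)
  · rw [one_div (_ + _), Complex.inv_re, Complex.normSq_apply]
    simp only [Complex.add_re, Complex.ofReal_re, Complex.mul_re, Complex.ofReal_im, Complex.I_re,
      Complex.I_im, mul_zero, sub_zero, add_zero, Complex.add_im, Complex.mul_im, mul_one, zero_add]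
    have hy2 : y * y ≤ (2 * s) * (2 * s) := by
      rw [← abs_mul_abs_self y]
      gcongr
    rw [div_le_div_iff₀ (by norm_num) (by nlinarith)]
    nlinarith
  · refine (norm_add_le _ _).trans ?_
    rw [norm_mul, Complex.norm_I, mul_one, Complex.norm_real, Complex.norm_real, Real.norm_eq_abs,
      Real.norm_eq_abs, abs_of_pos hs]
    linarith [Real.pi_gt_three]

lemma norm_two_pi_mul_sub_majorIntegral_le (n : ℕ) {s : ℝ} (hs : 0 < s) (hs1 : s ≤ 3 / 50) :
    ‖2 * Real.pi * overpartitionFn n - majorIntegral n s‖ ≤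
      2 * Real.pi * (‖mainTerm s‖ * Real.exp (-(Real.pi / (2 * s))) * Real.exp (n * s)) +
        4 * s * Real.exp (n * s) := by
  have hpi := Real.pi_gt_three
  set f : ℝ → ℂ := fun y => genFun (Complex.exp (-(s + y * Complex.I))) *
    Complex.exp (n * (s + y * Complex.I)) with hf
  have hfc : Continuous f := (continuous_genFun_exp hs).mul (by fun_prop)
  set m : ℝ → ℂ := fun y => mainTerm (s + y * Complex.I) * Complex.exp (n * (s + y * Complex.I))
    with hm
  have hmc : Continuous m := (continuousOn_mainTerm hs).mul (by fun_prop)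
  have hi : ∀ a b, IntervalIntegrable f MeasureTheory.volume a b :=
    fun a b => hfc.intervalIntegrable a b
  have h1 : 2 * Real.pi * (overpartitionFn n : ℂ) - majorIntegral n s =
      (∫ y in (-Real.pi)..(-(2 * s)), f y) + (∫ y in (-(2 * s))..(2 * s), (f y - m y)) +
        ∫ y in (2 * s)..Real.pi, f y := by
    rw [← two_pi_mul_overpartitionFn n hs, majorIntegral,
      intervalIntegral.integral_sub (hi _ _) (hmc.intervalIntegrable _ _),
      ← intervalIntegral.integral_add_adjacent_intervals (hi (-Real.pi) (2 * s)) (hi _ _),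
      ← intervalIntegral.integral_add_adjacent_intervals (hi (-Real.pi) (-(2 * s))) (hi _ _)]
    ring
  set M := ‖mainTerm s‖ * Real.exp (-(Real.pi / (2 * s))) * Real.exp (n * s) with hM
  have hM0 : 0 ≤ M := by positivity
  have h2 : ‖∫ y in (-Real.pi)..(-(2 * s)), f y‖ ≤ M * |-(2 * s) - -Real.pi| := by
    refine intervalIntegral.norm_integral_le_of_norm_le_const fun y hy => ?_
    rw [Set.uIoc_of_le (by linarith)] at hy
    have hyn : |y| = -y := abs_of_nonpos (by linarith [hy.2])
    exact norm_minor_integrand_le hs hs1 n (by linarith [hy.2]) (by linarith [hy.1])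
  have h3 : ‖∫ y in (2 * s)..Real.pi, f y‖ ≤ M * |Real.pi - 2 * s| := by
    refine intervalIntegral.norm_integral_le_of_norm_le_const fun y hy => ?_
    rw [Set.uIoc_of_le (by linarith)] at hy
    have hyn : |y| = y := abs_of_nonneg (by linarith [hy.1])
    exact norm_minor_integrand_le hs hs1 n (by linarith [hy.1]) (by linarith [hy.2])
  have h4 : ‖∫ y in (-(2 * s))..(2 * s), (f y - m y)‖ ≤ Real.exp (n * s) * |2 * s - -(2 * s)| := by
    refine intervalIntegral.norm_integral_le_of_norm_le_const fun y hy => ?_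
    rw [Set.uIoc_of_le (by linarith)] at hy
    simp only [hf, hm]
    rw [← sub_mul]
    exact norm_major_integrand_le hs hs1 n (abs_le.2 ⟨hy.1.le, hy.2⟩)
  rw [abs_of_nonneg (by linarith)] at h2 h3 h4
  rw [h1]
  refine (norm_add₃_le).trans ?_
  nlinarith

end Cauchy

section SaddlePoint

/-- The normalized integrand of the circle method; its saddle point is `w = 1`. -/
noncomputable def saddleIntegrand (z : ℝ) (w : ℂ) : ℂ :=
  w ^ (1 / 2 : ℂ) * Complex.exp (z / 2 * (w + 1 / w))

lemma re_pos_of_mem_ball {w : ℂ} (hw : w ∈ Metric.ball (3 : ℂ) 3) : 0 < w.re := by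
  rw [Metric.mem_ball, dist_eq_norm] at hw
  have := (Complex.abs_re_le_norm (w - 3)).trans_lt hw
  rw [abs_lt] at this
  simp at this
  linarith

lemma mem_ball_of_normSq {w : ℂ} (hw : w.re ^ 2 + w.im ^ 2 < 6 * w.re) :
    w ∈ Metric.ball (3 : ℂ) 3 := by
  rw [Metric.mem_ball, dist_eq_norm]
  refine lt_of_pow_lt_pow_left₀ 2 (by norm_num) ?_
  rw [← Complex.normSq_eq_norm_sq, Complex.normSq_apply]
  simp
  linarith

lemma exists_primitive_saddleIntegrand (z : ℝ) :
    ∃ H : ℂ → ℂ, ∀ w ∈ Metric.ball (3 : ℂ) 3, HasDerivAt H (saddleIntegrand z w) w := by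
  refine DifferentiableOn.isExactOn_ball fun w hw => ?_
  have h := re_pos_of_mem_ball hw
  have h0 : w ≠ 0 := by rintro rfl; simp at h
  refine DifferentiableAt.differentiableWithinAt ?_
  unfold saddleIntegrand
  have h1 : DifferentiableAt ℂ (fun w : ℂ => w ^ (1 / 2 : ℂ)) w :=
    differentiableAt_id.cpow_const (Or.inl h)
  have h2 : DifferentiableAt ℂ (fun w : ℂ => Complex.exp (z / 2 * (w + 1 / w))) w := by
    fun_prop (disch := assumption)
  exact h1.mul h2

/-- The segment `Re w ∈ [3/5, 1]` of the line through `1` and `1 + i c` used to leave the arc. -/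
def exitSegment (e : ℝ) : Set ℂ := {w | 3 / 5 ≤ w.re ∧ w.re ≤ 1 ∧ w.im = e * (3 * w.re - 1)}

lemma convex_exitSegment (e : ℝ) : Convex ℝ (exitSegment e) := by
  rintro x ⟨hx1, hx2, hx3⟩ y ⟨hy1, hy2, hy3⟩ a b ha hb hab
  obtain rfl : b = 1 - a := by linarith
  refine ⟨?_, ?_, ?_⟩
  · simp
    nlinarith
  · simp
    nlinarith
  · simp [hx3, hy3]
    ring

lemma exitSegment_subset {e : ℝ} (he : e ^ 2 = 1) {w : ℂ} (hw : w ∈ exitSegment e) :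
    w ∈ Metric.ball (3 : ℂ) 3 := by
  obtain ⟨h1, h2, h3⟩ := hw
  refine mem_ball_of_normSq ?_
  rw [h3, mul_pow, he]
  nlinarith

lemma norm_saddleIntegrand (z : ℝ) (w : ℂ) :
    ‖saddleIntegrand z w‖ = √‖w‖ * Real.exp (z / 2 * (w.re + w.re / Complex.normSq w)) := by
  have h2 : (1 / 2 : ℂ) = ((1 / 2 : ℝ) : ℂ) := by push_cast; rfl
  have h3 : (z / 2 * (w + 1 / w) : ℂ) = ((z / 2 : ℝ) : ℂ) * (w + 1 / w) := by push_cast; rfl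
  rw [saddleIntegrand, norm_mul, h2, Complex.norm_cpow_real, ← Real.sqrt_eq_rpow, Complex.norm_exp,
    h3, Complex.re_ofReal_mul, Complex.add_re, one_div w, Complex.inv_re]

lemma norm_saddleIntegrand_exit_le {e z : ℝ} (hz : 0 ≤ z) (he : e ^ 2 = 1) {w : ℂ}
    (hw : w ∈ exitSegment e) : ‖saddleIntegrand z w‖ ≤ 3 / 2 * Real.exp (3 / 5 * z) := by
  obtain ⟨h1, h2, h3⟩ := hw
  have hN : Complex.normSq w = 10 * w.re ^ 2 - 6 * w.re + 1 := by
    rw [Complex.normSq_apply, h3]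
    linear_combination (3 * w.re - 1) ^ 2 * he
  have hN0 : 0 < 10 * w.re ^ 2 - 6 * w.re + 1 := by nlinarith [sq_nonneg (w.re - 3 / 10)]
  rw [norm_saddleIntegrand, hN]
  refine mul_le_mul ?_ (Real.exp_le_exp.2 ?_) (Real.exp_nonneg _) (by norm_num)
  · have h5 : ‖w‖ ≤ (3 / 2) ^ 2 := by
      refine (sq_le_sq₀ (norm_nonneg _) (by norm_num)).1 ?_
      rw [← Complex.normSq_eq_norm_sq, hN]
      nlinarith
    exact (Real.sqrt_le_sqrt h5).trans_eq (Real.sqrt_sq (by norm_num))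
  · have h6 : w.re + w.re / (10 * w.re ^ 2 - 6 * w.re + 1) ≤ 6 / 5 := by
      rw [← le_sub_iff_add_le', div_le_iff₀ hN0]
      have h7 : 0 ≤ (w.re - 3 / 5) * (1 - w.re) * (w.re - 1 / 5) :=
        mul_nonneg (mul_nonneg (by linarith) (by linarith)) (by linarith)
      nlinarith
    nlinarith

lemma norm_primitive_exit_le {H : ℂ → ℂ} {e z : ℝ}
    (hH : ∀ w ∈ Metric.ball (3 : ℂ) 3, HasDerivAt H (saddleIntegrand z w) w) (hz : 0 ≤ z)
    (he : e ^ 2 = 1) :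
    ‖H (1 + 2 * e * Complex.I) - H (3 / 5 + 4 / 5 * e * Complex.I)‖ ≤ 2 * Real.exp (3 / 5 * z) := by
  have h1 : (3 / 5 + 4 / 5 * e * Complex.I : ℂ) ∈ exitSegment e := by
    refine ⟨?_, ?_, ?_⟩ <;> norm_num <;> ring
  have h2 : (1 + 2 * e * Complex.I : ℂ) ∈ exitSegment e := by
    refine ⟨?_, ?_, ?_⟩ <;> norm_num <;> ring
  have h3 := (convex_exitSegment e).norm_image_sub_le_of_norm_hasDerivWithin_le
    (fun w hw => (hH w (exitSegment_subset he hw)).hasDerivWithinAt)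
    (fun w hw => norm_saddleIntegrand_exit_le hz he hw) h1 h2
  have h4 : ‖(1 + 2 * e * Complex.I : ℂ) - (3 / 5 + 4 / 5 * e * Complex.I)‖ ≤ 4 / 3 := by
    refine (sq_le_sq₀ (norm_nonneg _) (by norm_num)).1 ?_
    rw [← Complex.normSq_eq_norm_sq, Complex.normSq_apply]
    norm_num
    nlinarith
  refine h3.trans ?_
  have := Real.exp_pos (3 / 5 * z)
  calc _ ≤ 3 / 2 * Real.exp (3 / 5 * z) * (4 / 3) := by gcongr
    _ = _ := by ring

/-- A primitive of `(1 - 4 s²) exp (z (1 - 2 s²))`. -/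
noncomputable def arcPrimitive (z s : ℝ) : ℝ :=
  Real.exp z * ((1 - 1 / z) * (∫ x in (0 : ℝ)..s, Real.exp (-(2 * z) * x ^ 2)) +
    s / z * Real.exp (-(2 * z) * s ^ 2))

lemma hasDerivAt_arcPrimitive {z : ℝ} (hz : z ≠ 0) (s : ℝ) :
    HasDerivAt (arcPrimitive z) ((1 - 4 * s ^ 2) * Real.exp (z * (1 - 2 * s ^ 2))) s := by
  have hc : Continuous fun x : ℝ => Real.exp (-(2 * z) * x ^ 2) := by fun_prop
  have h1 := (hc.integral_hasStrictDerivAt 0 s).hasDerivAt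
  have h2 : HasDerivAt (fun s : ℝ => Real.exp (-(2 * z) * s ^ 2))
      (Real.exp (-(2 * z) * s ^ 2) * (-(2 * z) * (2 * s))) s := by
    simpa using ((hasDerivAt_pow 2 s).const_mul (-(2 * z))).exp
  have h3 := (((h1.const_mul (1 - 1 / z)).add (((hasDerivAt_id s).div_const z).mul h2)).const_mul
    (Real.exp z))
  refine h3.congr_deriv ?_
  have h4 : Real.exp (z * (1 - 2 * s ^ 2)) = Real.exp z * Real.exp (-(2 * z) * s ^ 2) := by
    rw [← Real.exp_add]
    congr 1
    ring
  rw [h4]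
  simp only [id]
  field_simp
  ring

lemma abs_arcPrimitive_sub_le {z s : ℝ} (hz : 3 ≤ z) (hs0 : 0 < s) (hs : s ^ 2 = 1 / 5) :
    |arcPrimitive z s - Real.exp z * ((1 - 1 / z) * (√(Real.pi / (2 * z)) / 2))| ≤
      2 * Real.exp (3 / 5 * z) := by
  have h1 := integral_gaussian_Ioi (2 * z)
  have h_int : MeasureTheory.Integrable fun x : ℝ => Real.exp (-(2 * z) * x ^ 2) :=
    integrable_exp_neg_mul_sq (by linarith)
  have h2 := intervalIntegral.integral_interval_add_Ioi (a := 0) (b := s)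
    (h_int.integrableOn (s := Set.Ioi 0)) (h_int.integrableOn (s := Set.Ioi s))
  have h3 : ∫ x in Set.Ioi s, Real.exp (-(2 * z) * x ^ 2) ≤
      ∫ x in Set.Ioi s, Real.exp (-(2 * z * s) * x) := by
    refine MeasureTheory.setIntegral_mono_on h_int.integrableOn
      (integrableOn_exp_mul_Ioi (by nlinarith) s) measurableSet_Ioi fun x hx => ?_
    have hx' : s < x := hx
    refine Real.exp_le_exp.2 ?_
    have : s * x ≤ x ^ 2 := by nlinarith
    nlinarith
  rw [integral_exp_mul_Ioi (by nlinarith)] at h3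
  have h4 : 0 ≤ ∫ x in Set.Ioi s, Real.exp (-(2 * z) * x ^ 2) :=
    MeasureTheory.setIntegral_nonneg measurableSet_Ioi fun x _ => Real.exp_nonneg _
  have hs1 : 2 / 5 ≤ s := by nlinarith
  have hs2 : s ≤ 1 := by nlinarith
  have h5 : Real.exp (-(2 * z * s) * s) = Real.exp (-(2 / 5 * z)) := by
    congr 1
    linear_combination (-2 * z) * hs
  have h6 : Real.exp (-(2 * z) * s ^ 2) = Real.exp (-(2 / 5 * z)) := by
    congr 1
    linear_combination (-2 * z) * hs
  set T := ∫ x in Set.Ioi s, Real.exp (-(2 * z) * x ^ 2) with hT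
  set X := Real.exp (-(2 / 5 * z)) with hX
  have hX0 : 0 < X := Real.exp_pos _
  have h7 : T ≤ X := by
    refine h3.trans ?_
    rw [h5, neg_div_neg_eq, div_le_iff₀ (by nlinarith)]
    have : 1 ≤ 2 * z * s := by nlinarith
    nlinarith
  have h8 : Real.exp (3 / 5 * z) = Real.exp z * X := by
    rw [hX, ← Real.exp_add]
    congr 1
    ring
  have hI : ∫ x in (0 : ℝ)..s, Real.exp (-(2 * z) * x ^ 2) = √(Real.pi / (2 * z)) / 2 - T := by
    linarith
  rw [arcPrimitive, hI, h6, h8, ← mul_sub, abs_mul, abs_of_pos (Real.exp_pos z),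
    show 2 * (Real.exp z * X) = Real.exp z * (2 * X) by ring]
  refine mul_le_mul_of_nonneg_left ?_ (Real.exp_nonneg _)
  have hz1 : 0 ≤ 1 - 1 / z := by
    rw [sub_nonneg, div_le_one (by linarith)]
    linarith
  have hz2 : 0 < 1 / z := by positivity
  have h9 : s / z ≤ 1 := by
    rw [div_le_one (by linarith)]
    linarith
  have h10 : 0 ≤ s / z := by positivity
  rw [abs_le]
  constructor <;> nlinarith

lemma saddleIntegrand_exp (z : ℝ) {a : ℝ} (h1 : -(Real.pi / 2) < a) (h2 : a ≤ Real.pi / 2) :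
    saddleIntegrand z (Complex.exp (2 * Complex.I * a)) =
      Complex.exp (Complex.I * a) * Complex.exp (z * Real.cos (2 * a)) := by
  have h3 : Complex.log (Complex.exp (2 * Complex.I * a)) = 2 * Complex.I * a := by
    refine Complex.log_exp ?_ ?_ <;> simp <;> linarith
  rw [saddleIntegrand, Complex.cpow_def_of_ne_zero (Complex.exp_ne_zero _), h3]
  congr 2
  · ring
  · rw [one_div, ← Complex.exp_neg, Complex.ofReal_cos, Complex.cos]
    push_cast
    ring_nf

lemma exp_mem_ball {a : ℝ} (h : Real.sin a ^ 2 ≤ 1 / 5) :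
    Complex.exp (2 * Complex.I * a) ∈ Metric.ball (3 : ℂ) 3 := by
  have h1 : 2 * Complex.I * a = ((2 * a : ℝ) : ℂ) * Complex.I := by
    push_cast
    ring
  refine mem_ball_of_normSq ?_
  rw [h1, Complex.exp_ofReal_mul_I_re, Complex.exp_ofReal_mul_I_im]
  have h2 : Real.cos (2 * a) = 1 - 2 * Real.sin a ^ 2 := by
    rw [Real.cos_two_mul, Real.cos_sq']
    ring
  have := Real.sin_sq_add_cos_sq (2 * a)
  linarith

lemma hasDerivAt_primitive_arc {H : ℂ → ℂ} {z a : ℝ}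
    (hH : ∀ w ∈ Metric.ball (3 : ℂ) 3, HasDerivAt H (saddleIntegrand z w) w)
    (ha : Real.sin a ^ 2 ≤ 1 / 5) (h1 : -(Real.pi / 2) < a) (h2 : a ≤ Real.pi / 2) :
    HasDerivAt (fun a : ℝ => H (Complex.exp (2 * Complex.I * a)))
      (2 * Complex.I * Complex.exp (3 * Complex.I * a) * Complex.exp (z * Real.cos (2 * a))) a := by
  have h3 : HasDerivAt (fun a : ℂ => Complex.exp (2 * Complex.I * a))
      (Complex.exp (2 * Complex.I * a) * (2 * Complex.I)) (a : ℂ) := by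
    simpa using ((hasDerivAt_id (a : ℂ)).const_mul (2 * Complex.I)).cexp
  have h4 := (HasDerivAt.comp (a : ℂ) (hH _ (exp_mem_ball ha)) h3).comp_ofReal
  refine h4.congr_deriv ?_
  rw [saddleIntegrand_exp z h1 h2]
  have h5 : Complex.exp (3 * Complex.I * a) =
      Complex.exp (Complex.I * a) * Complex.exp (2 * Complex.I * a) := by
    rw [← Complex.exp_add]
    congr 1
    ring
  rw [h5]
  ring

lemma primitive_arc_eq {H : ℂ → ℂ} {z s : ℝ} (hz : z ≠ 0)
    (hH : ∀ w ∈ Metric.ball (3 : ℂ) 3, HasDerivAt H (saddleIntegrand z w) w)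
    (hs0 : 0 < s) (hs : s ^ 2 = 1 / 5) :
    H (3 / 5 + 4 / 5 * Complex.I) - H (3 / 5 - 4 / 5 * Complex.I) =
      4 * Complex.I * arcPrimitive z s := by
  have hs1 : s < 1 := by nlinarith
  set b := Real.arcsin s with hb
  have hb0 : 0 ≤ b := Real.arcsin_nonneg.2 hs0.le
  have hb1 : b < Real.pi / 2 := Real.arcsin_lt_pi_div_two.2 hs1
  have hsinb : Real.sin b = s := Real.sin_arcsin (by linarith) hs1.le
  set D : ℝ → ℂ := fun a => H (Complex.exp (2 * Complex.I * a)) -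
    H (Complex.exp (2 * Complex.I * ((-a : ℝ) : ℂ))) -
      4 * Complex.I * (arcPrimitive z (Real.sin a) : ℂ) with hD
  have hder : ∀ a ∈ Set.Icc 0 b, HasDerivAt D 0 a := by
    intro a ha
    have ha0 : 0 ≤ Real.sin a := Real.sin_nonneg_of_nonneg_of_le_pi ha.1 (by linarith [ha.2])
    have ha1 : Real.sin a ≤ s := by
      rw [← hsinb]
      exact Real.sin_le_sin_of_le_of_le_pi_div_two (by linarith [ha.1]) hb1.le ha.2
    have ha2 : Real.sin a ^ 2 ≤ 1 / 5 := by
      rw [← hs]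
      gcongr
    have h1 := hasDerivAt_primitive_arc hH ha2 (by linarith [ha.1]) (by linarith [ha.2])
    have h2 := hasDerivAt_primitive_arc (a := -a) hH (by rwa [Real.sin_neg, neg_sq])
      (by linarith [ha.2]) (by linarith [ha.1])
    have h3 := h2.scomp a (hasDerivAt_neg a)
    have h4 := (((hasDerivAt_arcPrimitive hz (Real.sin a)).comp a
      (Real.hasDerivAt_sin a)).ofReal_comp).const_mul (4 * Complex.I)
    have h5 := (h1.sub h3).sub h4
    refine h5.congr_deriv ?_
    have h6 : Complex.exp (3 * Complex.I * a) + Complex.exp (3 * Complex.I * ((-a : ℝ) : ℂ)) =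
        2 * ((Real.cos a * (1 - 4 * Real.sin a ^ 2) : ℝ) : ℂ) := by
      have h7 : Real.cos a * (1 - 4 * Real.sin a ^ 2) = Real.cos (3 * a) := by
        rw [Real.cos_three_mul, Real.sin_sq]
        ring
      rw [h7, Complex.ofReal_cos, Complex.cos]
      push_cast
      ring_nf
    have h8 : z * (1 - 2 * Real.sin a ^ 2) = z * Real.cos (2 * a) := by
      rw [Real.cos_two_mul, Real.sin_sq]
      ring
    have h9 : Real.cos (2 * -a) = Real.cos (2 * a) := by rw [mul_neg, Real.cos_neg]
    rw [h8, h9]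
    push_cast at h6 ⊢
    simp only [neg_smul, one_smul]
    linear_combination (2 * Complex.I * Complex.exp (z * Complex.cos (2 * a))) * h6
  have hconst := constant_of_has_deriv_right_zero (f := D) (a := 0) (b := b)
    (fun a ha => (hder a ha).continuousAt.continuousWithinAt)
    (fun a ha => (hder a ⟨ha.1, ha.2.le⟩).hasDerivWithinAt) b ⟨hb0, le_rfl⟩
  have hcos : Real.cos (2 * b) = 3 / 5 := by
    rw [Real.cos_two_mul, Real.cos_sq', hsinb, hs]
    norm_num
  have hsin : Real.sin (2 * b) = 4 / 5 := by
    have h1 : 0 ≤ Real.sin (2 * b) := Real.sin_nonneg_of_nonneg_of_le_pi (by linarith) (by linarith)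
    have h2 := Real.sin_sq_add_cos_sq (2 * b)
    rw [hcos] at h2
    nlinarith
  have e1 : Complex.exp (2 * Complex.I * b) = 3 / 5 + 4 / 5 * Complex.I := by
    have : 2 * Complex.I * b = ((2 * b : ℝ) : ℂ) * Complex.I := by push_cast; ring
    rw [this, Complex.exp_mul_I, ← Complex.ofReal_cos, ← Complex.ofReal_sin, hcos, hsin]
    push_cast
    ring
  have e2 : Complex.exp (2 * Complex.I * ((-b : ℝ) : ℂ)) = 3 / 5 - 4 / 5 * Complex.I := by
    have : 2 * Complex.I * ((-b : ℝ) : ℂ) = ((-(2 * b) : ℝ) : ℂ) * Complex.I := by push_cast; ring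
    rw [this, Complex.exp_mul_I, ← Complex.ofReal_cos, ← Complex.ofReal_sin, Real.cos_neg,
      Real.sin_neg, hcos, hsin]
    push_cast
    ring
  have h0 : arcPrimitive z 0 = 0 := by simp [arcPrimitive]
  simp only [hD, e1, e2, hsinb, Real.sin_zero, h0, neg_zero, Complex.ofReal_zero, mul_zero, sub_self]
    at hconst
  linear_combination hconst

/-- The Laplace method along the vertical segment from `1 - 2 * I` to `1 + 2 * I`. -/
lemma norm_primitive_sub_le {H : ℂ → ℂ} {z : ℝ} (hz : 3 ≤ z)
    (hH : ∀ w ∈ Metric.ball (3 : ℂ) 3, HasDerivAt H (saddleIntegrand z w) w) :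
    ‖H (1 + 2 * Complex.I) - H (1 - 2 * Complex.I) -
      2 * Complex.I * ((Real.exp z * (1 - 1 / z) * √(Real.pi / (2 * z)) : ℝ) : ℂ)‖ ≤
      12 * Real.exp (3 / 5 * z) := by
  have hs0 : 0 < √(1 / 5 : ℝ) := by positivity
  have hs : √(1 / 5 : ℝ) ^ 2 = 1 / 5 := Real.sq_sqrt (by norm_num)
  have h1 := primitive_arc_eq (by linarith) hH hs0 hs
  have h2 := abs_arcPrimitive_sub_le hz hs0 hs
  have h3 := norm_primitive_exit_le (e := 1) hH (by linarith) (by norm_num)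
  have h4 := norm_primitive_exit_le (e := -1) hH (by linarith) (by norm_num)
  set A := arcPrimitive z √(1 / 5) with hA
  set M := Real.exp z * ((1 - 1 / z) * (√(Real.pi / (2 * z)) / 2)) with hM
  have e1 : (1 + 2 * ((1 : ℝ) : ℂ) * Complex.I) = 1 + 2 * Complex.I := by push_cast; ring
  have e2 : (3 / 5 + 4 / 5 * ((1 : ℝ) : ℂ) * Complex.I) = 3 / 5 + 4 / 5 * Complex.I := by
    push_cast; ring
  have e3 : (1 + 2 * ((-1 : ℝ) : ℂ) * Complex.I) = 1 - 2 * Complex.I := by push_cast; ring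
  have e4 : (3 / 5 + 4 / 5 * ((-1 : ℝ) : ℂ) * Complex.I) = 3 / 5 - 4 / 5 * Complex.I := by
    push_cast; ring
  rw [e1, e2] at h3
  rw [e3, e4] at h4
  have h5 : H (1 + 2 * Complex.I) - H (1 - 2 * Complex.I) -
      2 * Complex.I * ((Real.exp z * (1 - 1 / z) * √(Real.pi / (2 * z)) : ℝ) : ℂ) =
      (H (1 + 2 * Complex.I) - H (3 / 5 + 4 / 5 * Complex.I)) +
      4 * Complex.I * ((A - M : ℝ) : ℂ) +
      -(H (1 - 2 * Complex.I) - H (3 / 5 - 4 / 5 * Complex.I)) := by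
    have h6 : (Real.exp z * (1 - 1 / z) * √(Real.pi / (2 * z)) : ℝ) = 2 * M := by
      rw [hM]
      ring
    rw [h6]
    push_cast
    linear_combination h1
  rw [h5]
  refine norm_add₃_le.trans ?_
  rw [norm_neg, norm_mul, norm_mul, Complex.norm_I, Complex.norm_real, Real.norm_eq_abs]
  norm_num
  linarith

end SaddlePoint

section Asymptotics

lemma mainTerm_mul_exp_eq {n : ℕ} {s z : ℝ} (hs : 0 < s) (hns : n * s = z / 2)
    (hsz : Real.pi ^ 2 = 2 * z * s) (y : ℝ) :
    mainTerm (s + y * Complex.I) * Complex.exp (n * (s + y * Complex.I)) =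
      ((√(s / Real.pi) / 2 : ℝ) : ℂ) * saddleIntegrand z (1 + ((y / s : ℝ) : ℂ) * Complex.I) := by
  have hpi := Real.pi_pos
  set w : ℂ := 1 + ((y / s : ℝ) : ℂ) * Complex.I with hw
  have hs' : (s : ℂ) ≠ 0 := by exact_mod_cast hs.ne'
  have hw0 : w ≠ 0 := by
    intro h
    have := congrArg Complex.re h
    simp [hw] at this
  have e1 : (s + y * Complex.I : ℂ) = s * w := by
    rw [hw]
    push_cast
    field_simp
  have e2 : (s * w / Real.pi : ℂ) = ((s / Real.pi : ℝ) : ℂ) * w := by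
    push_cast
    ring
  have e3 : ((s / Real.pi : ℝ) : ℂ) ^ (1 / 2 : ℂ) = (√(s / Real.pi) : ℝ) := by
    rw [Real.sqrt_eq_rpow, Complex.ofReal_cpow (by positivity)]
    norm_num
  have e4 : (Real.pi ^ 2 : ℂ) = 2 * z * s := by exact_mod_cast hsz
  have e5 : (n * s : ℂ) = z / 2 := by exact_mod_cast hns
  have e6 : (Real.pi ^ 2 / (4 * (s * w)) + n * (s * w) : ℂ) = z / 2 * (w + 1 / w) := by
    rw [← mul_assoc (n : ℂ), e5, e4]
    field_simp
    ring
  have e7 : (((s / Real.pi : ℝ) : ℂ) * w) ^ (1 / 2 : ℂ) =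
      ((s / Real.pi : ℝ) : ℂ) ^ (1 / 2 : ℂ) * w ^ (1 / 2 : ℂ) := by
    have h0 : ((s / Real.pi : ℝ) : ℂ) ≠ 0 := by exact_mod_cast (by positivity : s / Real.pi ≠ 0)
    rw [Complex.cpow_def_of_ne_zero (mul_ne_zero h0 hw0), Complex.cpow_def_of_ne_zero h0,
      Complex.cpow_def_of_ne_zero hw0, Complex.log_ofReal_mul (by positivity) hw0, ← Complex.exp_add,
      Complex.ofReal_log (by positivity)]
    ring_nf
  rw [e1, mainTerm, e2, e7, e3, mul_assoc, ← Complex.exp_add, e6, saddleIntegrand]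
  push_cast
  ring

lemma norm_majorIntegral_sub_le {n : ℕ} {s z : ℝ} (hs : 0 < s) (hns : n * s = z / 2)
    (hsz : Real.pi ^ 2 = 2 * z * s) (hz : 3 ≤ z) :
    ‖majorIntegral n s - ((s ^ 2 / Real.pi * (Real.exp z * (1 - 1 / z)) : ℝ) : ℂ)‖ ≤
      √(s / Real.pi) * s * (6 * Real.exp (3 / 5 * z)) := by
  have hpi := Real.pi_pos
  have hs' : (s : ℂ) ≠ 0 := by exact_mod_cast hs.ne'
  obtain ⟨H, hH⟩ := exists_primitive_saddleIntegrand z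
  set r := √(s / Real.pi) with hr
  have hr2 : r ^ 2 = s / Real.pi := Real.sq_sqrt (by positivity)
  have hder : ∀ y ∈ Set.uIcc (-(2 * s)) (2 * s), HasDerivAt
      (fun y : ℝ => ((r / 2 : ℝ) : ℂ) * (s / Complex.I) * H (1 + ((y / s : ℝ) : ℂ) * Complex.I))
      (mainTerm (s + y * Complex.I) * Complex.exp (n * (s + y * Complex.I))) y := by
    intro y hy
    rw [Set.uIcc_of_le (by linarith)] at hy
    have hys : (y / s) ^ 2 ≤ 4 := by
      rw [div_pow, div_le_iff₀ (by positivity)]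
      nlinarith [hy.1, hy.2]
    have hball : 1 + ((y / s : ℝ) : ℂ) * Complex.I ∈ Metric.ball (3 : ℂ) 3 := by
      refine mem_ball_of_normSq ?_
      simp only [Complex.add_re, Complex.one_re, Complex.re_ofReal_mul, Complex.I_re, mul_zero,
        Complex.add_im, Complex.one_im, Complex.im_ofReal_mul, Complex.I_im, mul_one, zero_add]
      linarith
    have h1 : HasDerivAt (fun y : ℝ => 1 + ((y / s : ℝ) : ℂ) * Complex.I)
        (((1 / s : ℝ) : ℂ) * Complex.I) y :=
      ((((hasDerivAt_id y).div_const s).ofReal_comp).mul_const Complex.I).const_add 1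
    have h2 := ((hH _ hball).scomp y h1).const_mul (((r / 2 : ℝ) : ℂ) * (s / Complex.I))
    refine h2.congr_deriv ?_
    rw [mainTerm_mul_exp_eq hs hns hsz, smul_eq_mul, ← hr]
    push_cast
    field_simp
  have hc : Continuous fun y : ℝ =>
      mainTerm (s + y * Complex.I) * Complex.exp (n * (s + y * Complex.I)) :=
    (continuousOn_mainTerm hs).mul (by fun_prop)
  rw [majorIntegral, intervalIntegral.integral_eq_sub_of_hasDerivAt hder
    (hc.intervalIntegrable _ _)]
  have e1 : ((2 * s / s : ℝ) : ℂ) = 2 := by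
    rw [mul_div_assoc, div_self hs.ne']
    norm_num
  have e2 : ((-(2 * s) / s : ℝ) : ℂ) = -2 := by
    rw [neg_div, mul_div_assoc, div_self hs.ne']
    norm_num
  have e3 : Real.pi / (2 * z) = s / Real.pi := by
    rw [div_eq_div_iff (by positivity) hpi.ne']
    linarith
  have h := norm_primitive_sub_le hz hH
  rw [e3] at h
  have e4 : ((r / 2 : ℝ) : ℂ) * (s / Complex.I) * H (1 + ((2 * s / s : ℝ) : ℂ) * Complex.I) -
      ((r / 2 : ℝ) : ℂ) * (s / Complex.I) * H (1 + ((-(2 * s) / s : ℝ) : ℂ) * Complex.I) -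
      ((s ^ 2 / Real.pi * (Real.exp z * (1 - 1 / z)) : ℝ) : ℂ) =
      ((r / 2 * s : ℝ) : ℂ) / Complex.I * (H (1 + 2 * Complex.I) - H (1 - 2 * Complex.I) -
      2 * Complex.I * ((Real.exp z * (1 - 1 / z) * r : ℝ) : ℂ)) := by
    have e5 : s ^ 2 / Real.pi * (Real.exp z * (1 - 1 / z)) =
        r / 2 * s * 2 * (Real.exp z * (1 - 1 / z) * r) := by
      linear_combination (-(s * (Real.exp z * (1 - 1 / z)))) * hr2
    rw [e1, e2, e5]
    push_cast
    rw [show (1 + -2 * Complex.I : ℂ) = 1 - 2 * Complex.I by ring]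
    have := Complex.I_ne_zero
    field_simp
  rw [e4, norm_mul, norm_div, Complex.norm_I, Complex.norm_real, Real.norm_eq_abs,
    abs_of_nonneg (by positivity)]
  calc r / 2 * s / 1 * _ ≤ r / 2 * s / 1 * (12 * Real.exp (3 / 5 * z)) := by gcongr
    _ = _ := by ring

/-- The main term of the Hardy–Ramanujan–Rademacher expansion of `overpartitionFn`. -/
noncomputable def asymp (x : ℝ) : ℝ :=
  Real.exp (Real.pi * √x) * (1 - 1 / (Real.pi * √x)) / (8 * x)

lemma abs_overpartitionFn_sub_asymp_le {n : ℕ} (hn : 729 ≤ n) :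
    |overpartitionFn n - asymp n| ≤ Real.exp ((Real.pi - 1) * √n) / 4 := by
  have hpi := Real.pi_gt_three
  have hpi2 := Real.pi_lt_d2
  set x := √(n : ℝ) with hx
  have hx27 : 27 ≤ x := by
    rw [hx, show (27 : ℝ) = √(27 ^ 2) by rw [Real.sqrt_sq (by norm_num)]]
    refine Real.sqrt_le_sqrt ?_
    have : (729 : ℝ) ≤ n := by exact_mod_cast hn
    linarith
  have hxx : x ^ 2 = n := Real.sq_sqrt (by positivity)
  have hx0 : 0 < x := by linarith
  set s := Real.pi / (2 * x) with hs
  set z := Real.pi * x with hz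
  have hs0 : 0 < s := by positivity
  have hns : n * s = z / 2 := by
    rw [← hxx, hs, hz]
    field_simp
  have hsz : Real.pi ^ 2 = 2 * z * s := by
    rw [hs, hz]
    field_simp
  have hs1 : s ≤ 3 / 50 := by
    rw [hs, div_le_iff₀ (by positivity)]
    nlinarith
  have h1 := norm_two_pi_mul_sub_majorIntegral_le n hs0 hs1
  have h2 := norm_majorIntegral_sub_le hs0 hns hsz (by nlinarith)
  have hsp : s / Real.pi = 1 / (2 * x) := by
    rw [hs]
    field_simp
  have hm : ‖mainTerm s‖ = √(s / Real.pi) / 2 * Real.exp (z / 2) := by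
    rw [norm_mainTerm, Complex.norm_real, Real.norm_eq_abs, abs_of_pos hs0]
    congr 2
    rw [one_div, ← Complex.ofReal_inv, Complex.ofReal_re, hs, hz]
    field_simp
    norm_num
  have h3 : ‖((2 * Real.pi * (overpartitionFn n - asymp n) : ℝ) : ℂ)‖ ≤
      2 * Real.pi * (‖mainTerm s‖ * Real.exp (-(Real.pi / (2 * s))) * Real.exp (n * s)) +
        4 * s * Real.exp (n * s) + √(s / Real.pi) * s * (6 * Real.exp (3 / 5 * z)) := by
    refine le_trans (le_of_eq ?_) ((norm_add_le _ _).trans (add_le_add h1 h2))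
    congr 1
    have : s ^ 2 / Real.pi * (Real.exp z * (1 - 1 / z)) = 2 * Real.pi * asymp n := by
      rw [asymp, ← hx, ← hz, ← hxx, hs]
      field_simp
      ring
    rw [this]
    push_cast
    ring
  rw [Complex.norm_real, Real.norm_eq_abs, abs_mul, abs_of_pos (by positivity), hm, hns, hsp] at h3
  have hr : √(1 / (2 * x)) ≤ 1 / 5 := by
    rw [show (1 / 5 : ℝ) = √((1 / 5) ^ 2) by rw [Real.sqrt_sq (by norm_num)]]
    refine Real.sqrt_le_sqrt ?_
    rw [div_le_iff₀ (by positivity)]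
    linarith
  set X := Real.exp ((Real.pi - 1) * x) with hX
  have hX0 : 0 < X := Real.exp_pos _
  have e1 : Real.exp (z / 2) * Real.exp (-(Real.pi / (2 * s))) * Real.exp (z / 2) = X := by
    rw [← Real.exp_add, ← Real.exp_add, hX, hz, hs]
    congr 1
    field_simp
    ring
  have e2 : Real.exp (z / 2) ≤ X := Real.exp_le_exp.2 (by rw [hz]; nlinarith)
  have e3 : Real.exp (3 / 5 * z) ≤ X := Real.exp_le_exp.2 (by rw [hz]; nlinarith)
  have h4 : √(1 / (2 * x)) / 2 * Real.exp (z / 2) * Real.exp (-(Real.pi / (2 * s))) *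
      Real.exp (z / 2) ≤ 1 / 10 * X := by
    rw [show √(1 / (2 * x)) / 2 * Real.exp (z / 2) * Real.exp (-(Real.pi / (2 * s))) *
      Real.exp (z / 2) = √(1 / (2 * x)) / 2 *
        (Real.exp (z / 2) * Real.exp (-(Real.pi / (2 * s))) * Real.exp (z / 2)) by ring, e1]
    refine mul_le_mul_of_nonneg_right ?_ hX0.le
    linarith
  have h5 : 4 * s * Real.exp (z / 2) ≤ 4 * (3 / 50) * X := by gcongr
  have h6 : √(1 / (2 * x)) * s * (6 * Real.exp (3 / 5 * z)) ≤ 1 / 5 * (3 / 50) * (6 * X) := by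
    gcongr
  have h7 : 2 * Real.pi * |overpartitionFn n - asymp n| ≤ 2 * Real.pi * (X / 4) := by
    refine h3.trans ?_
    have : 2 * Real.pi * (√(1 / (2 * x)) / 2 * Real.exp (z / 2) * Real.exp (-(Real.pi / (2 * s))) *
      Real.exp (z / 2)) ≤ 2 * Real.pi * (1 / 10 * X) := by gcongr
    nlinarith
  exact le_of_mul_le_mul_left h7 (by positivity)

end Asymptotics

section LogDerivatives

/-- `x ^ (-1/2)`. -/
noncomputable def invSqrt (x : ℝ) : ℝ := (√x)⁻¹

/-- `1 / (π - x ^ (-1/2))`. -/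
noncomputable def piGap (x : ℝ) : ℝ := (Real.pi - invSqrt x)⁻¹

lemma invSqrt_pos {x : ℝ} (hx : 0 < x) : 0 < invSqrt x := by
  unfold invSqrt
  positivity

lemma invSqrt_sq {x : ℝ} (hx : 0 < x) : invSqrt x ^ 2 = x⁻¹ := by
  rw [invSqrt, inv_pow, Real.sq_sqrt hx.le]

lemma invSqrt_anti {x y : ℝ} (hx : 0 < x) (h : x ≤ y) : invSqrt y ≤ invSqrt x := by
  unfold invSqrt
  gcongr

lemma invSqrt_le {x : ℝ} (hx : 2500 ≤ x) : invSqrt x ≤ 1 / 50 := by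
  refine (invSqrt_anti (by norm_num) hx).trans_eq ?_
  rw [invSqrt, show (2500 : ℝ) = 50 ^ 2 by norm_num, Real.sqrt_sq (by norm_num)]
  norm_num

lemma piGap_pos {x : ℝ} (hx : 2500 ≤ x) : 0 < piGap x := by
  have := Real.pi_gt_three
  exact inv_pos.2 (by linarith [invSqrt_le hx])

lemma piGap_le {x : ℝ} (hx : 2500 ≤ x) : piGap x ≤ 1 / 3 := by
  have := Real.pi_gt_d2
  rw [piGap, one_div]
  gcongr
  linarith [invSqrt_le hx]

lemma hasDerivAt_invSqrt {x : ℝ} (hx : 0 < x) :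
    HasDerivAt invSqrt (-(1 / 2) * invSqrt x ^ 3) x := by
  have h := (Real.hasDerivAt_sqrt hx.ne').inv (by positivity)
  refine h.congr_deriv ?_
  rw [invSqrt]
  field_simp

lemma hasDerivAt_piGap {x : ℝ} (hx : 2500 ≤ x) :
    HasDerivAt piGap (-(1 / 2) * invSqrt x ^ 3 * piGap x ^ 2) x := by
  have h0 : Real.pi - invSqrt x ≠ 0 := by
    have := Real.pi_gt_three
    linarith [invSqrt_le hx]
  have h := ((hasDerivAt_invSqrt (by linarith)).const_sub Real.pi).inv h0
  refine h.congr_deriv ?_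
  rw [piGap]
  field_simp

lemma hasDerivAt_monomial {x : ℝ} (hx : 2500 ≤ x) (c : ℝ) (a b : ℕ) :
    HasDerivAt (fun x => c * invSqrt x ^ (a + 1) * piGap x ^ b)
      (-(c / 2) * (((a + 1 : ℕ) : ℝ) * invSqrt x ^ (a + 3) * piGap x ^ b +
        b * invSqrt x ^ (a + 4) * piGap x ^ (b + 1))) x := by
  have h1 := ((hasDerivAt_invSqrt (x := x) (by linarith)).pow (a + 1)).const_mul c
  have h2 := h1.mul ((hasDerivAt_piGap hx).pow b)
  refine h2.congr_deriv ?_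
  rcases b with _ | b
  · simp
    ring
  · simp
    ring

/-- The logarithm of `8 π · asymp`. -/
noncomputable def logAsymp (x : ℝ) : ℝ :=
  Real.pi * √x + Real.log (Real.pi * √x - 1) - 3 * Real.log √x

/-- The first derivative of `logAsymp`. -/
noncomputable def logAsymp1 (x : ℝ) : ℝ :=
  Real.pi / 2 * invSqrt x ^ 1 * piGap x ^ 0 + -1 * invSqrt x ^ 2 * piGap x ^ 0 +
    1 / 2 * invSqrt x ^ 3 * piGap x ^ 1

/-- The second derivative of `logAsymp`. -/
noncomputable def logAsymp2 (x : ℝ) : ℝ :=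
  -(Real.pi / 4) * invSqrt x ^ 3 * piGap x ^ 0 + 1 * invSqrt x ^ 4 * piGap x ^ 0 +
    -(3 / 4) * invSqrt x ^ 5 * piGap x ^ 1 + -(1 / 4) * invSqrt x ^ 6 * piGap x ^ 2

/-- The third derivative of `logAsymp`. -/
noncomputable def logAsymp3 (x : ℝ) : ℝ :=
  3 / 8 * Real.pi * invSqrt x ^ 5 * piGap x ^ 0 + -2 * invSqrt x ^ 6 * piGap x ^ 0 +
    15 / 8 * invSqrt x ^ 7 * piGap x ^ 1 + 9 / 8 * invSqrt x ^ 8 * piGap x ^ 2 +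
    1 / 4 * invSqrt x ^ 9 * piGap x ^ 3

/-- The fourth derivative of `logAsymp`. -/
noncomputable def logAsymp4 (x : ℝ) : ℝ :=
  -(15 / 16 * Real.pi) * invSqrt x ^ 7 * piGap x ^ 0 + 6 * invSqrt x ^ 8 * piGap x ^ 0 +
    -(105 / 16) * invSqrt x ^ 9 * piGap x ^ 1 + -(87 / 16) * invSqrt x ^ 10 * piGap x ^ 2 +
    -(9 / 4) * invSqrt x ^ 11 * piGap x ^ 3 + -(3 / 8) * invSqrt x ^ 12 * piGap x ^ 4

/-- The fifth derivative of `logAsymp`. -/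
noncomputable def logAsymp5 (x : ℝ) : ℝ :=
  105 / 32 * Real.pi * invSqrt x ^ 9 * piGap x ^ 0 + -24 * invSqrt x ^ 10 * piGap x ^ 0 +
    945 / 32 * invSqrt x ^ 11 * piGap x ^ 1 + 975 / 32 * invSqrt x ^ 12 * piGap x ^ 2 +
    285 / 16 * invSqrt x ^ 13 * piGap x ^ 3 + 45 / 8 * invSqrt x ^ 14 * piGap x ^ 4 +
    3 / 4 * invSqrt x ^ 15 * piGap x ^ 5

lemma fifty_le_sqrt {x : ℝ} (hx : 2500 ≤ x) : 50 ≤ √x := by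
  rw [show (50 : ℝ) = √(50 ^ 2) by rw [Real.sqrt_sq (by norm_num)]]
  exact Real.sqrt_le_sqrt (by linarith)

lemma hasDerivAt_logAsymp {x : ℝ} (hx : 2500 ≤ x) : HasDerivAt logAsymp (logAsymp1 x) x := by
  have hr := fifty_le_sqrt hx
  have hpi := Real.pi_gt_three
  have h0 : Real.pi * √x - 1 ≠ 0 := by nlinarith
  have h1 := Real.hasDerivAt_sqrt (x := x) (by linarith)
  have h2 := (h1.const_mul Real.pi)
  have h3 := ((h2.sub_const 1).log h0)
  have h4 := (h1.log (by linarith)).const_mul 3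
  refine ((h2.add h3).sub h4).congr_deriv ?_
  have h5 : √x ≠ 0 := by linarith
  have h6 : piGap x = √x / (Real.pi * √x - 1) := by
    rw [piGap, invSqrt, ← inv_div]
    congr 1
    field_simp
  rw [logAsymp1, h6, invSqrt]
  field_simp
  ring

lemma hasDerivAt_logAsymp1 {x : ℝ} (hx : 2500 ≤ x) : HasDerivAt logAsymp1 (logAsymp2 x) x := by
  refine (((hasDerivAt_monomial hx _ 0 0).add (hasDerivAt_monomial hx _ 1 0)).add
    (hasDerivAt_monomial hx _ 2 1)).congr_deriv ?_
  rw [logAsymp2]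
  push_cast
  ring

lemma hasDerivAt_logAsymp2 {x : ℝ} (hx : 2500 ≤ x) : HasDerivAt logAsymp2 (logAsymp3 x) x := by
  refine ((((hasDerivAt_monomial hx _ 2 0).add (hasDerivAt_monomial hx _ 3 0)).add
    (hasDerivAt_monomial hx _ 4 1)).add (hasDerivAt_monomial hx _ 5 2)).congr_deriv ?_
  rw [logAsymp3]
  push_cast
  ring

lemma hasDerivAt_logAsymp3 {x : ℝ} (hx : 2500 ≤ x) : HasDerivAt logAsymp3 (logAsymp4 x) x := by
  refine (((((hasDerivAt_monomial hx _ 4 0).add (hasDerivAt_monomial hx _ 5 0)).add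
    (hasDerivAt_monomial hx _ 6 1)).add (hasDerivAt_monomial hx _ 7 2)).add
    (hasDerivAt_monomial hx _ 8 3)).congr_deriv ?_
  rw [logAsymp4]
  push_cast
  ring

lemma hasDerivAt_logAsymp4 {x : ℝ} (hx : 2500 ≤ x) : HasDerivAt logAsymp4 (logAsymp5 x) x := by
  refine ((((((hasDerivAt_monomial hx _ 6 0).add (hasDerivAt_monomial hx _ 7 0)).add
    (hasDerivAt_monomial hx _ 8 1)).add (hasDerivAt_monomial hx _ 9 2)).add
    (hasDerivAt_monomial hx _ 10 3)).add (hasDerivAt_monomial hx _ 11 4)).congr_deriv ?_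
  rw [logAsymp5]
  push_cast
  ring

lemma monomial_mem {p t : ℝ} (hp0 : 0 ≤ p) (hp : p ≤ 1 / 50) (ht0 : 0 ≤ t) (ht : t ≤ 1 / 3)
    (a b : ℕ) : 0 ≤ p ^ (a + 1) * t ^ b ∧ p ^ (a + 1) * t ^ b ≤ 1 / 50 * (1 / 50) ^ a := by
  refine ⟨by positivity, ?_⟩
  calc p ^ (a + 1) * t ^ b ≤ (1 / 50) ^ (a + 1) * 1 :=
        mul_le_mul (pow_le_pow_left₀ hp0 hp _) (pow_le_one₀ ht0 (by linarith)) (by positivity)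
          (by positivity)
    _ = _ := by ring

lemma le_logAsymp1 {x : ℝ} (hx : 2500 ≤ x) : 3 / 2 * invSqrt x ≤ logAsymp1 x := by
  have hp0 := invSqrt_pos (x := x) (by linarith)
  have hp := invSqrt_le hx
  have hT := piGap_pos hx
  have hpi := Real.pi_gt_d2
  have : 0 ≤ 1 / 2 * invSqrt x ^ 3 * piGap x ^ 1 := by positivity
  rw [logAsymp1]
  nlinarith

lemma logAsymp2_bounds {x : ℝ} (hx : 2500 ≤ x) :
    -(4 / 5) * invSqrt x ^ 3 ≤ logAsymp2 x ∧ logAsymp2 x ≤ -(3 / 4) * invSqrt x ^ 3 := by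
  have hp0 := invSqrt_pos (x := x) (by linarith)
  have M := monomial_mem hp0.le (invSqrt_le hx) (piGap_pos hx).le (piGap_le hx)
  have hpi := Real.pi_gt_d2
  have hpi2 := Real.pi_lt_d2
  have e : logAsymp2 x = invSqrt x ^ 3 * (-(Real.pi / 4) + invSqrt x -
      3 / 4 * (invSqrt x ^ (1 + 1) * piGap x ^ 1) -
      1 / 4 * (invSqrt x ^ (2 + 1) * piGap x ^ 2)) := by
    rw [logAsymp2]
    ring
  have hP : 0 < invSqrt x ^ 3 := by positivity
  have b1 := invSqrt_le hx
  obtain ⟨a2, b2⟩ := M 1 1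
  obtain ⟨a3, b3⟩ := M 2 2
  rw [e, mul_comm _ (invSqrt x ^ 3), mul_comm _ (invSqrt x ^ 3)]
  generalize invSqrt x ^ (1 + 1) * piGap x ^ 1 = m2 at a2 b2 ⊢
  generalize invSqrt x ^ (2 + 1) * piGap x ^ 2 = m3 at a3 b3 ⊢
  constructor <;> refine mul_le_mul_of_nonneg_left ?_ hP.le <;> linarith

lemma abs_logAsymp3_le {x : ℝ} (hx : 2500 ≤ x) : |logAsymp3 x| ≤ 3 / 2 * invSqrt x ^ 5 := by
  have hp0 := invSqrt_pos (x := x) (by linarith)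
  have M := monomial_mem hp0.le (invSqrt_le hx) (piGap_pos hx).le (piGap_le hx)
  have hpi := Real.pi_gt_d2
  have hpi2 := Real.pi_lt_d2
  have e : logAsymp3 x = invSqrt x ^ 5 * (3 / 8 * Real.pi - 2 * invSqrt x +
      15 / 8 * (invSqrt x ^ (1 + 1) * piGap x ^ 1) + 9 / 8 * (invSqrt x ^ (2 + 1) * piGap x ^ 2) +
      1 / 4 * (invSqrt x ^ (3 + 1) * piGap x ^ 3)) := by
    rw [logAsymp3]
    ring
  have hP : 0 < invSqrt x ^ 5 := by positivity
  have b1 := invSqrt_le hx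
  obtain ⟨a2, b2⟩ := M 1 1
  obtain ⟨a3, b3⟩ := M 2 2
  obtain ⟨a4, b4⟩ := M 3 3
  rw [e, abs_mul, abs_of_pos hP, mul_comm _ (invSqrt x ^ 5)]
  generalize invSqrt x ^ (1 + 1) * piGap x ^ 1 = m2 at a2 b2 ⊢
  generalize invSqrt x ^ (2 + 1) * piGap x ^ 2 = m3 at a3 b3 ⊢
  generalize invSqrt x ^ (3 + 1) * piGap x ^ 3 = m4 at a4 b4 ⊢
  refine mul_le_mul_of_nonneg_left (abs_le.2 ?_) hP.le
  constructor <;> linarith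

lemma abs_logAsymp4_le {x : ℝ} (hx : 2500 ≤ x) : |logAsymp4 x| ≤ 4 * invSqrt x ^ 7 := by
  have hp0 := invSqrt_pos (x := x) (by linarith)
  have M := monomial_mem hp0.le (invSqrt_le hx) (piGap_pos hx).le (piGap_le hx)
  have hpi := Real.pi_gt_d2
  have hpi2 := Real.pi_lt_d2
  have e : logAsymp4 x = invSqrt x ^ 7 * (-(15 / 16 * Real.pi) +
      6 * invSqrt x - 105 / 16 * (invSqrt x ^ (1 + 1) * piGap x ^ 1) -
      87 / 16 * (invSqrt x ^ (2 + 1) * piGap x ^ 2) -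
      9 / 4 * (invSqrt x ^ (3 + 1) * piGap x ^ 3) -
      3 / 8 * (invSqrt x ^ (4 + 1) * piGap x ^ 4)) := by
    rw [logAsymp4]
    ring
  have hP : 0 < invSqrt x ^ 7 := by positivity
  have b1 := invSqrt_le hx
  obtain ⟨a2, b2⟩ := M 1 1
  obtain ⟨a3, b3⟩ := M 2 2
  obtain ⟨a4, b4⟩ := M 3 3
  obtain ⟨a5, b5⟩ := M 4 4
  rw [e, abs_mul, abs_of_pos hP, mul_comm _ (invSqrt x ^ 7)]
  generalize invSqrt x ^ (1 + 1) * piGap x ^ 1 = m2 at a2 b2 ⊢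
  generalize invSqrt x ^ (2 + 1) * piGap x ^ 2 = m3 at a3 b3 ⊢
  generalize invSqrt x ^ (3 + 1) * piGap x ^ 3 = m4 at a4 b4 ⊢
  generalize invSqrt x ^ (4 + 1) * piGap x ^ 4 = m5 at a5 b5 ⊢
  refine mul_le_mul_of_nonneg_left (abs_le.2 ?_) hP.le
  constructor <;> linarith

lemma abs_logAsymp5_le {x : ℝ} (hx : 2500 ≤ x) : |logAsymp5 x| ≤ 12 * invSqrt x ^ 9 := by
  have hp0 := invSqrt_pos (x := x) (by linarith)
  have M := monomial_mem hp0.le (invSqrt_le hx) (piGap_pos hx).le (piGap_le hx)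
  have hpi := Real.pi_gt_d2
  have hpi2 := Real.pi_lt_d2
  have e : logAsymp5 x = invSqrt x ^ 9 * (105 / 32 * Real.pi -
      24 * invSqrt x + 945 / 32 * (invSqrt x ^ (1 + 1) * piGap x ^ 1) +
      975 / 32 * (invSqrt x ^ (2 + 1) * piGap x ^ 2) +
      285 / 16 * (invSqrt x ^ (3 + 1) * piGap x ^ 3) +
      45 / 8 * (invSqrt x ^ (4 + 1) * piGap x ^ 4) +
      3 / 4 * (invSqrt x ^ (5 + 1) * piGap x ^ 5)) := by
    rw [logAsymp5]
    ring
  have hP : 0 < invSqrt x ^ 9 := by positivity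
  have b1 := invSqrt_le hx
  obtain ⟨a2, b2⟩ := M 1 1
  obtain ⟨a3, b3⟩ := M 2 2
  obtain ⟨a4, b4⟩ := M 3 3
  obtain ⟨a5, b5⟩ := M 4 4
  obtain ⟨a6, b6⟩ := M 5 5
  rw [e, abs_mul, abs_of_pos hP, mul_comm _ (invSqrt x ^ 9)]
  generalize invSqrt x ^ (1 + 1) * piGap x ^ 1 = m2 at a2 b2 ⊢
  generalize invSqrt x ^ (2 + 1) * piGap x ^ 2 = m3 at a3 b3 ⊢
  generalize invSqrt x ^ (3 + 1) * piGap x ^ 3 = m4 at a4 b4 ⊢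
  generalize invSqrt x ^ (4 + 1) * piGap x ^ 4 = m5 at a5 b5 ⊢
  generalize invSqrt x ^ (5 + 1) * piGap x ^ 5 = m6 at a6 b6 ⊢
  refine mul_le_mul_of_nonneg_left (abs_le.2 ?_) hP.le
  constructor <;> linarith

end LogDerivatives

section LogDifference

/-- The forward difference with step one. -/
def fwd (F : ℝ → ℝ) (x : ℝ) : ℝ := F (x + 1) - F x

lemma hasDerivAt_fwd {F F' : ℝ → ℝ} (h : ∀ x, 2500 ≤ x → HasDerivAt F (F' x) x) {x : ℝ}
    (hx : 2500 ≤ x) : HasDerivAt (fwd F) (fwd F' x) x :=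
  ((h (x + 1) (by linarith)).comp_add_const x 1).sub (h x hx)

lemma exists_fwd_eq {F F' : ℝ → ℝ} (h : ∀ x, 2500 ≤ x → HasDerivAt F (F' x) x) {x : ℝ}
    (hx : 2500 ≤ x) : ∃ y, x ≤ y ∧ y ≤ x + 1 ∧ fwd F x = F' y := by
  obtain ⟨y, hy, h1⟩ := exists_hasDerivAt_eq_slope F F' (by linarith : x < x + 1)
    (fun y hy => (h y (hx.trans hy.1)).continuousAt.continuousWithinAt)
    (fun y hy => h y (hx.trans hy.1.le))
  refine ⟨y, hy.1.le, hy.2.le, ?_⟩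
  rw [h1, fwd]
  simp

/-- `1 / (exp ρ - 1)` for the forward difference `ρ` of `logAsymp`. -/
noncomputable def bose (x : ℝ) : ℝ := (Real.exp (fwd logAsymp x) - 1)⁻¹

/-- The logarithm of `8 π` times the forward difference of `asymp`. -/
noncomputable def logDiff (x : ℝ) : ℝ :=
  logAsymp x + Real.log (Real.exp (fwd logAsymp x) - 1)

/-- The first derivative of `logDiff`. -/
noncomputable def logDiff1 (x : ℝ) : ℝ := logAsymp1 x + fwd logAsymp1 x * (1 + bose x)

/-- The second derivative of `logDiff`. -/
noncomputable def logDiff2 (x : ℝ) : ℝ :=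
  logAsymp2 x + fwd logAsymp2 x * (1 + bose x) -
    bose x * (1 + bose x) * fwd logAsymp1 x ^ 2

/-- The third derivative of `logDiff`. -/
noncomputable def logDiff3 (x : ℝ) : ℝ :=
  logAsymp3 x + fwd logAsymp3 x * (1 + bose x) -
    3 * (bose x * (1 + bose x)) * (fwd logAsymp1 x * fwd logAsymp2 x) +
    bose x * (1 + bose x) * (1 + 2 * bose x) * fwd logAsymp1 x ^ 3

/-- The fourth derivative of `logDiff`. -/
noncomputable def logDiff4 (x : ℝ) : ℝ :=
  logAsymp4 x + fwd logAsymp4 x * (1 + bose x) -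
    bose x * (1 + bose x) *
      (4 * (fwd logAsymp1 x * fwd logAsymp3 x) + 3 * fwd logAsymp2 x ^ 2) +
    6 * (bose x * (1 + bose x) * (1 + 2 * bose x)) * (fwd logAsymp1 x ^ 2 * fwd logAsymp2 x) -
    (bose x * (1 + bose x) * (1 + 2 * bose x) ^ 2 + 2 * (bose x * (1 + bose x)) ^ 2) *
      fwd logAsymp1 x ^ 4

lemma invSqrt_add_one {x : ℝ} (hx : 2500 ≤ x) : 99 / 100 * invSqrt x ≤ invSqrt (x + 1) := by
  have h0 := invSqrt_pos (x := x + 1) (by linarith)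
  refine (sq_le_sq₀ (by linarith [invSqrt_pos (x := x) (by linarith)]) h0.le).1 ?_
  rw [mul_pow, invSqrt_sq (by linarith), invSqrt_sq (by linarith), ← div_eq_mul_inv, ← one_div,
    div_le_div_iff₀ (by linarith) (by linarith)]
  linarith

lemma le_fwd_logAsymp {x : ℝ} (hx : 2500 ≤ x) : 7 / 5 * invSqrt x ≤ fwd logAsymp x := by
  obtain ⟨y, hy1, hy2, h⟩ := exists_fwd_eq (fun _ => hasDerivAt_logAsymp) hx
  have h1 := le_logAsymp1 (hx.trans hy1)
  have h2 := invSqrt_anti (by linarith) hy2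
  have h3 := invSqrt_add_one hx
  have h4 := invSqrt_pos (x := x) (by linarith)
  linarith

lemma abs_fwd_le {F F' : ℝ → ℝ} {C : ℝ} {k : ℕ} (hC : 0 ≤ C)
    (h : ∀ x, 2500 ≤ x → HasDerivAt F (F' x) x)
    (hb : ∀ x, 2500 ≤ x → |F' x| ≤ C * invSqrt x ^ k) {x : ℝ} (hx : 2500 ≤ x) :
    |fwd F x| ≤ C * invSqrt x ^ k := by
  obtain ⟨y, hy1, hy2, h⟩ := exists_fwd_eq h hx
  rw [h]
  refine (hb y (hx.trans hy1)).trans (mul_le_mul_of_nonneg_left ?_ hC)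
  exact pow_le_pow_left₀ (invSqrt_pos (by linarith)).le (invSqrt_anti (by linarith) hy1) _

lemma exp_fwd_sub_one_pos {x : ℝ} (hx : 2500 ≤ x) :
    7 / 5 * invSqrt x ≤ Real.exp (fwd logAsymp x) - 1 := by
  linarith [le_fwd_logAsymp hx, Real.add_one_le_exp (fwd logAsymp x)]

lemma bose_pos {x : ℝ} (hx : 2500 ≤ x) : 0 < bose x :=
  inv_pos.2 (by linarith [exp_fwd_sub_one_pos hx, invSqrt_pos (x := x) (by linarith)])

lemma bose_mul_le {x : ℝ} (hx : 2500 ≤ x) : bose x * invSqrt x ≤ 5 / 7 := by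
  have h1 := exp_fwd_sub_one_pos hx
  have h2 := invSqrt_pos (x := x) (by linarith)
  rw [bose, ← div_eq_inv_mul, div_le_iff₀ (by linarith)]
  linarith

lemma hasDerivAt_bose {x : ℝ} (hx : 2500 ≤ x) :
    HasDerivAt bose (-(bose x * (1 + bose x)) * fwd logAsymp1 x) x := by
  have h0 : Real.exp (fwd logAsymp x) - 1 ≠ 0 := by
    linarith [exp_fwd_sub_one_pos hx, invSqrt_pos (x := x) (by linarith)]
  have h := ((hasDerivAt_fwd (fun _ => hasDerivAt_logAsymp) hx).exp.sub_const 1).inv h0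
  refine h.congr_deriv ?_
  rw [bose]
  field_simp
  ring

lemma hasDerivAt_logDiff {x : ℝ} (hx : 2500 ≤ x) : HasDerivAt logDiff (logDiff1 x) x := by
  have h0 : Real.exp (fwd logAsymp x) - 1 ≠ 0 := by
    linarith [exp_fwd_sub_one_pos hx, invSqrt_pos (x := x) (by linarith)]
  have h := ((hasDerivAt_fwd (fun _ => hasDerivAt_logAsymp) hx).exp.sub_const 1).log h0
  refine ((hasDerivAt_logAsymp hx).add h).congr_deriv ?_
  rw [logDiff1, bose]
  field_simp
  ring

lemma hasDerivAt_logDiff1 {x : ℝ} (hx : 2500 ≤ x) : HasDerivAt logDiff1 (logDiff2 x) x := by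
  have h1 := hasDerivAt_fwd (fun _ => hasDerivAt_logAsymp1) hx
  have hE := hasDerivAt_bose hx
  refine ((hasDerivAt_logAsymp1 hx).add (h1.mul (hE.const_add 1))).congr_deriv ?_
  rw [logDiff2]
  ring

lemma hasDerivAt_logDiff2 {x : ℝ} (hx : 2500 ≤ x) : HasDerivAt logDiff2 (logDiff3 x) x := by
  have h1 := hasDerivAt_fwd (fun _ => hasDerivAt_logAsymp1) hx
  have h2 := hasDerivAt_fwd (fun _ => hasDerivAt_logAsymp2) hx
  have hE := hasDerivAt_bose hx
  have hE1 := hE.const_add 1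
  refine (((hasDerivAt_logAsymp2 hx).add (h2.mul hE1)).sub
    ((hE.mul hE1).mul (h1.pow 2))).congr_deriv ?_
  rw [logDiff3]
  push_cast [Pi.mul_apply, Pi.pow_apply]
  ring

lemma hasDerivAt_logDiff3 {x : ℝ} (hx : 2500 ≤ x) : HasDerivAt logDiff3 (logDiff4 x) x := by
  have h1 := hasDerivAt_fwd (fun _ => hasDerivAt_logAsymp1) hx
  have h2 := hasDerivAt_fwd (fun _ => hasDerivAt_logAsymp2) hx
  have h3 := hasDerivAt_fwd (fun _ => hasDerivAt_logAsymp3) hx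
  have hE := hasDerivAt_bose hx
  have hE1 := hE.const_add 1
  have hV := hE.mul hE1
  refine ((((hasDerivAt_logAsymp3 hx).add (h3.mul hE1)).sub
    ((hV.const_mul 3).mul (h1.mul h2))).add
    ((hV.mul ((hE.const_mul 2).const_add 1)).mul (h1.pow 3))).congr_deriv ?_
  rw [logDiff4]
  push_cast [Pi.mul_apply, Pi.pow_apply]
  ring

lemma logDiff2_le {x : ℝ} (hx : 2500 ≤ x) : logDiff2 x ≤ -(7 / 10) * invSqrt x ^ 3 := by
  have hp0 := invSqrt_pos (x := x) (by linarith)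
  have hp := invSqrt_le hx
  have hE0 := bose_pos hx
  have hE := bose_mul_le hx
  have h2 := (logAsymp2_bounds hx).2
  have h3 := abs_fwd_le (by norm_num) (fun _ => hasDerivAt_logAsymp2)
    (fun _ => abs_logAsymp3_le) hx
  rw [logDiff2]
  have h4 : 0 ≤ bose x * (1 + bose x) * fwd logAsymp1 x ^ 2 := by positivity
  have h5 : fwd logAsymp2 x * (1 + bose x) ≤ 3 / 2 * invSqrt x ^ 5 * (1 + bose x) := by
    gcongr
    exact (le_abs_self _).trans h3
  have h6 : 3 / 2 * invSqrt x ^ 5 * (1 + bose x) ≤ 1 / 20 * invSqrt x ^ 3 := by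
    have h7 : invSqrt x * (1 + bose x) ≤ 3 / 4 := by linarith
    calc 3 / 2 * invSqrt x ^ 5 * (1 + bose x)
        = 3 / 2 * invSqrt x * (invSqrt x * (1 + bose x)) * invSqrt x ^ 3 := by ring
      _ ≤ 3 / 2 * (1 / 50) * (3 / 4) * invSqrt x ^ 3 := by gcongr
      _ ≤ _ := by
        have : 0 < invSqrt x ^ 3 := by positivity
        linarith
  linarith

lemma abs_logDiff4_le {x : ℝ} (hx : 2500 ≤ x) : |logDiff4 x| ≤ 1 / 5 * invSqrt x ^ 6 := by
  have hp0 := invSqrt_pos (x := x) (by linarith)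
  have hp := invSqrt_le hx
  have hE0 := bose_pos hx
  have hE := bose_mul_le hx
  have a4 := abs_logAsymp4_le hx
  have r1 := abs_fwd_le (by norm_num) (C := 4 / 5) (k := 3) (fun _ => hasDerivAt_logAsymp1)
    (fun x hx => by
      have := logAsymp2_bounds hx
      have h0 : 0 < invSqrt x ^ 3 := by
        have := invSqrt_pos (x := x) (by linarith)
        positivity
      rw [abs_le]
      constructor <;> linarith) hx
  have r2 := abs_fwd_le (by norm_num) (fun _ => hasDerivAt_logAsymp2)
    (fun _ => abs_logAsymp3_le) hx
  have r3 := abs_fwd_le (by norm_num) (fun _ => hasDerivAt_logAsymp3)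
    (fun _ => abs_logAsymp4_le) hx
  have r4 := abs_fwd_le (by norm_num) (fun _ => hasDerivAt_logAsymp4)
    (fun _ => abs_logAsymp5_le) hx
  set p := invSqrt x
  set E := bose x
  have hE1 : (1 + E) * p ≤ 3 / 4 := by linarith
  have hE2 : (1 + 2 * E) * p ≤ 3 / 2 := by linarith
  have hP : 0 < p ^ 6 := by positivity
  have t1 : |logAsymp4 x| ≤ 4 / 50 * p ^ 6 :=
    a4.trans <| calc 4 * p ^ 7 = 4 * p * p ^ 6 := by ring
      _ ≤ 4 * (1 / 50) * p ^ 6 := by gcongr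
      _ = _ := by ring
  have hp2 : p ^ 2 ≤ 1 / 2500 := by nlinarith
  have t2 : |fwd logAsymp4 x * (1 + E)| ≤ 9 / 2500 * p ^ 6 := by
    rw [abs_mul, abs_of_pos (by positivity : 0 < 1 + E)]
    calc _ ≤ 12 * p ^ 9 * (1 + E) := by gcongr
      _ = 12 * ((1 + E) * p) * p ^ 2 * p ^ 6 := by ring
      _ ≤ 12 * (3 / 4) * (1 / 2500) * p ^ 6 := by gcongr
      _ = _ := by ring
  have t3 : |E * (1 + E) * (4 * (fwd logAsymp1 x * fwd logAsymp3 x) + 3 * fwd logAsymp2 x ^ 2)| ≤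
      11 / 2500 * p ^ 6 := by
    rw [abs_mul, abs_of_pos (by positivity : 0 < E * (1 + E))]
    have hs : |4 * (fwd logAsymp1 x * fwd logAsymp3 x) + 3 * fwd logAsymp2 x ^ 2| ≤
        4 * (4 / 5 * p ^ 3 * (4 * p ^ 7)) + 3 * (3 / 2 * p ^ 5) ^ 2 := by
      refine (abs_add_le _ _).trans ?_
      rw [abs_mul, abs_mul, abs_mul, abs_pow, abs_of_pos (by norm_num : (0 : ℝ) < 4),
        abs_of_pos (by norm_num : (0 : ℝ) < 3)]
      gcongr
    calc _ ≤ E * (1 + E) * (4 * (4 / 5 * p ^ 3 * (4 * p ^ 7)) + 3 * (3 / 2 * p ^ 5) ^ 2) := by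
          gcongr
      _ = (E * p) * ((1 + E) * p) * p ^ 2 * (391 / 20) * p ^ 6 := by ring
      _ ≤ 5 / 7 * (3 / 4) * (1 / 2500) * (391 / 20) * p ^ 6 := by gcongr
      _ ≤ _ := by linarith
  have t4 : |6 * (E * (1 + E) * (1 + 2 * E)) * (fwd logAsymp1 x ^ 2 * fwd logAsymp2 x)| ≤
      5 / 2500 * p ^ 6 := by
    rw [abs_mul, abs_of_pos (by positivity : 0 < 6 * (E * (1 + E) * (1 + 2 * E))), abs_mul, abs_pow]
    calc _ ≤ 6 * (E * (1 + E) * (1 + 2 * E)) * ((4 / 5 * p ^ 3) ^ 2 * (3 / 2 * p ^ 5)) := by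
          gcongr
      _ = 6 * ((E * p) * ((1 + E) * p) * ((1 + 2 * E) * p)) * p ^ 2 * (24 / 25) * p ^ 6 := by ring
      _ ≤ 6 * (5 / 7 * (3 / 4) * (3 / 2)) * (1 / 2500) * (24 / 25) * p ^ 6 := by gcongr
      _ ≤ _ := by linarith
  have t5 : |(E * (1 + E) * (1 + 2 * E) ^ 2 + 2 * (E * (1 + E)) ^ 2) * fwd logAsymp1 x ^ 4| ≤
      1 / 2500 * p ^ 6 := by
    rw [abs_mul, abs_of_pos (by positivity), abs_pow]
    calc _ ≤ (E * (1 + E) * (1 + 2 * E) ^ 2 + 2 * (E * (1 + E)) ^ 2) * (4 / 5 * p ^ 3) ^ 4 := by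
          gcongr
      _ = (256 / 625) * ((E * p) * ((1 + E) * p) * ((1 + 2 * E) * p) ^ 2 +
            2 * ((E * p) * ((1 + E) * p)) ^ 2) * p ^ 2 * p ^ 6 := by ring
      _ ≤ (256 / 625) * (5 / 7 * (3 / 4) * (3 / 2) ^ 2 + 2 * (5 / 7 * (3 / 4)) ^ 2) *
            (1 / 2500) * p ^ 6 := by gcongr
      _ ≤ _ := by linarith
  rw [abs_le] at t1 t2 t3 t4 t5 ⊢
  rw [logDiff4]
  constructor <;> linarith [t1.1, t1.2, t2.1, t2.2, t3.1, t3.2, t4.1, t4.2, t5.1, t5.2]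

end LogDifference

section LogConcavity

/-- The central second difference with step one. -/
def secondDiff (F : ℝ → ℝ) (x : ℝ) : ℝ := F (x + 1) + F (x - 1) - 2 * F x

lemma le_secondDiff {F F' F'' : ℝ → ℝ} {x m : ℝ}
    (h1 : ∀ y ∈ Set.Icc (x - 1) (x + 1), HasDerivAt F (F' y) y)
    (h2 : ∀ y ∈ Set.Icc (x - 1) (x + 1), HasDerivAt F' (F'' y) y)
    (hm : ∀ y ∈ Set.Icc (x - 1) (x + 1), m ≤ F'' y) : m ≤ secondDiff F x := by
  set K : ℝ → ℝ := fun t => F (x + t) + F (x - t) - m * t ^ 2 with hK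
  have hder : ∀ t ∈ Set.Icc (0 : ℝ) 1, HasDerivAt K (F' (x + t) - F' (x - t) - 2 * m * t) t := by
    intro t ht
    have e1 := (h1 (x + t) ⟨by linarith [ht.1], by linarith [ht.2]⟩).comp_const_add x t
    have e2 := (h1 (x - t) ⟨by linarith [ht.2], by linarith [ht.1]⟩).comp_const_sub x t
    refine ((e1.add e2).sub ((hasDerivAt_pow 2 t).const_mul m)).congr_deriv ?_
    push_cast
    ring
  have hmono : MonotoneOn K (Set.Icc 0 1) := by
    refine monotoneOn_of_hasDerivWithinAt_nonneg (convex_Icc 0 1)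
      (fun t ht => (hder t ht).continuousAt.continuousWithinAt)
      (fun t ht => (hder t (interior_subset ht)).hasDerivWithinAt) fun t ht => ?_
    rw [interior_Icc] at ht
    obtain ⟨y, hy, h3⟩ := exists_hasDerivAt_eq_slope F' F'' (by linarith [ht.1] : x - t < x + t)
      (fun y hy => (h2 y ⟨by linarith [hy.1, ht.2], by linarith [hy.2, ht.2]⟩).continuousAt.continuousWithinAt)
      (fun y hy => h2 y ⟨by linarith [hy.1, ht.2], by linarith [hy.2, ht.2]⟩)
    have h4 := hm y ⟨by linarith [hy.1, ht.2], by linarith [hy.2, ht.2]⟩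
    rw [h3, le_div_iff₀ (by linarith [ht.1])] at h4
    linarith
  have h5 := hmono ⟨le_rfl, zero_le_one⟩ ⟨zero_le_one, le_rfl⟩ zero_le_one
  simp only [hK, add_zero, sub_zero] at h5
  rw [secondDiff]
  linarith

lemma secondDiff_logDiff_le {x : ℝ} (hx : 2501 ≤ x) :
    secondDiff logDiff x ≤ -(7 / 10) * invSqrt (x + 1) ^ 3 := by
  have h := le_secondDiff (x := x) (F := fun y => -logDiff y) (F' := fun y => -logDiff1 y)
    (F'' := fun y => -logDiff2 y) (m := 7 / 10 * invSqrt (x + 1) ^ 3)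
    (fun y hy => (hasDerivAt_logDiff (by linarith [hy.1])).neg)
    (fun y hy => (hasDerivAt_logDiff1 (by linarith [hy.1])).neg) fun y hy => by
      have h1 := logDiff2_le (x := y) (by linarith [hy.1])
      have h2 : invSqrt (x + 1) ^ 3 ≤ invSqrt y ^ 3 :=
        pow_le_pow_left₀ (invSqrt_pos (by linarith)).le
          (invSqrt_anti (by linarith [hy.1]) hy.2) 3
      linarith
  simp only [secondDiff] at h ⊢
  linarith

lemma le_secondDiff_secondDiff_logDiff {x : ℝ} (hx : 2502 ≤ x) :
    -(1 / 5) * invSqrt (x - 2) ^ 6 ≤ secondDiff (secondDiff logDiff) x := by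
  have hsub : ∀ {F F' : ℝ → ℝ}, (∀ y, 2500 ≤ y → HasDerivAt F (F' y) y) → ∀ y, 2501 ≤ y →
      HasDerivAt (secondDiff F) (secondDiff F' y) y := fun h y hy =>
    (((h (y + 1) (by linarith)).comp_add_const y 1).add
      ((h (y - 1) (by linarith)).comp_sub_const y 1)).sub ((h y (by linarith)).const_mul 2)
  refine le_secondDiff (fun y hy => hsub (fun _ => hasDerivAt_logDiff) y (by linarith [hy.1]))
    (fun y hy => hsub (fun _ => hasDerivAt_logDiff1) y (by linarith [hy.1])) fun y hy => ?_
  refine le_secondDiff (fun u hu => hasDerivAt_logDiff2 (by linarith [hu.1, hy.1]))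
    (fun u hu => hasDerivAt_logDiff3 (by linarith [hu.1, hy.1])) fun u hu => ?_
  have h1 := (abs_le.1 (abs_logDiff4_le (x := u) (by linarith [hu.1, hy.1]))).1
  have h2 : invSqrt u ^ 6 ≤ invSqrt (x - 2) ^ 6 :=
    pow_le_pow_left₀ (invSqrt_pos (by linarith [hu.1, hy.1])).le
      (invSqrt_anti (by linarith) (by linarith [hu.1, hy.1])) 6
  linarith

/-- A criterion for the positivity of a `3 × 3` Toeplitz determinant of a log-concave sequence. -/
lemma toeplitz_det_pos {a0 a1 a2 a3 a4 u1 u2 u3 : ℝ} (h0 : 0 < a0) (h1 : 0 < a1) (h2 : 0 < a2)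
    (h3 : 0 < a3) (h4 : 0 < a4) (hu1 : u1 = Real.log a1 * 2 - Real.log a0 - Real.log a2)
    (hu2 : u2 = Real.log a2 * 2 - Real.log a1 - Real.log a3)
    (hu3 : u3 = Real.log a3 * 2 - Real.log a2 - Real.log a4)
    (hu2' : 0 < u2) (hm0 : 0 ≤ u1 + u3) (h : (u1 + u3) / 2 - u2 < u2 ^ 2) :
    0 < (a2 ^ 2 - a1 * a3) ^ 2 - (a1 ^ 2 - a0 * a2) * (a3 ^ 2 - a2 * a4) := by
  have e0 : a1 * a3 = a2 ^ 2 * Real.exp (-u2) := by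
    rw [hu2, show -(Real.log a2 * 2 - Real.log a1 - Real.log a3) =
      Real.log a1 + Real.log a3 - Real.log a2 - Real.log a2 by ring, Real.exp_sub, Real.exp_sub,
      Real.exp_add, Real.exp_log h1, Real.exp_log h2, Real.exp_log h3]
    field_simp
  have e1 : a0 * a2 = a1 ^ 2 * Real.exp (-u1) := by
    rw [hu1, show -(Real.log a1 * 2 - Real.log a0 - Real.log a2) =
      Real.log a0 + Real.log a2 - Real.log a1 - Real.log a1 by ring, Real.exp_sub, Real.exp_sub,
      Real.exp_add, Real.exp_log h0, Real.exp_log h1, Real.exp_log h2]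
    field_simp
  have e2 : a2 * a4 = a3 ^ 2 * Real.exp (-u3) := by
    rw [hu3, show -(Real.log a3 * 2 - Real.log a2 - Real.log a4) =
      Real.log a2 + Real.log a4 - Real.log a3 - Real.log a3 by ring, Real.exp_sub, Real.exp_sub,
      Real.exp_add, Real.exp_log h4, Real.exp_log h2, Real.exp_log h3]
    field_simp
  set m := (u1 + u3) / 2 with hm
  have e3 : (1 - Real.exp (-u1)) * (1 - Real.exp (-u3)) ≤ (1 - Real.exp (-m)) ^ 2 := by
    set v1 := Real.exp (-(u1 / 2)) with hv1
    set v3 := Real.exp (-(u3 / 2)) with hv3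
    have f1 : Real.exp (-u1) = v1 ^ 2 := by rw [hv1, ← Real.exp_nat_mul]; congr 1; push_cast; ring
    have f3 : Real.exp (-u3) = v3 ^ 2 := by rw [hv3, ← Real.exp_nat_mul]; congr 1; push_cast; ring
    have fm : Real.exp (-m) = v1 * v3 := by rw [hv1, hv3, ← Real.exp_add]; congr 1; rw [hm]; ring
    rw [f1, f3, fm]
    nlinarith [sq_nonneg (v1 - v3)]
  have e4 : Real.exp (-u2) * (1 - Real.exp (-m)) < 1 - Real.exp (-u2) := by
    set U := Real.exp (-u2) with hU
    have hU0 : 0 < U := Real.exp_pos _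
    have g1 : Real.exp (-m) = U * Real.exp (-(m - u2)) := by
      rw [hU, ← Real.exp_add]
      congr 1
      ring
    have g2 : 1 - (m - u2) ≤ Real.exp (-(m - u2)) := Real.one_sub_le_exp_neg _
    have g3 : U * u2 ≤ 1 - U := by
      have g4 : U * Real.exp u2 = 1 := by rw [hU, ← Real.exp_add, neg_add_cancel, Real.exp_zero]
      nlinarith [Real.add_one_le_exp u2]
    have g5 : (U * u2) ^ 2 ≤ (1 - U) ^ 2 := pow_le_pow_left₀ (by positivity) g3 2
    have g6 : 0 < U ^ 2 := by positivity
    have g7 : U ^ 2 * (1 - (m - u2)) ≤ U ^ 2 * Real.exp (-(m - u2)) := by gcongr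
    have g8 : U ^ 2 * (m - u2) < U ^ 2 * u2 ^ 2 := by gcongr
    rw [g1]
    nlinarith
  have e5 : 0 ≤ Real.exp (-u2) * (1 - Real.exp (-m)) :=
    mul_nonneg (Real.exp_nonneg _) (sub_nonneg.2 (Real.exp_le_one_iff.2 (by linarith)))
  have e6 : (a1 ^ 2 - a0 * a2) * (a3 ^ 2 - a2 * a4) =
      (a1 * a3) ^ 2 * ((1 - Real.exp (-u1)) * (1 - Real.exp (-u3))) := by
    rw [e1, e2]
    ring
  rw [e6, e0]
  have e7 : (a2 ^ 2 * Real.exp (-u2)) ^ 2 * ((1 - Real.exp (-u1)) * (1 - Real.exp (-u3))) ≤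
      (a2 ^ 2 * Real.exp (-u2)) ^ 2 * (1 - Real.exp (-m)) ^ 2 := by gcongr
  have e8 : (Real.exp (-u2) * (1 - Real.exp (-m))) ^ 2 < (1 - Real.exp (-u2)) ^ 2 :=
    pow_lt_pow_left₀ e4 e5 two_ne_zero
  have e9 : 0 < (a2 ^ 2) ^ 2 := by positivity
  nlinarith

end LogConcavity

section LargeIndex

lemma asymp_eq_exp {x : ℝ} (hx : 2500 ≤ x) :
    asymp x = Real.exp (logAsymp x) / (8 * Real.pi) := by
  have hr := fifty_le_sqrt hx
  have hpi := Real.pi_gt_three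
  have h0 : 0 < Real.pi * √x - 1 := by nlinarith
  have h1 : 0 < √x := by linarith
  have h2 : Real.exp (3 * Real.log √x) = √x ^ 3 := by
    rw [mul_comm, Real.exp_mul, Real.exp_log h1]
    norm_cast
  have h3 : x = √x ^ 2 := (Real.sq_sqrt (by linarith)).symm
  rw [logAsymp, Real.exp_sub, Real.exp_add, Real.exp_log h0, h2, asymp]
  nth_rw 3 [h3]
  field_simp

lemma asymp_sub_asymp_eq_exp {x : ℝ} (hx : 2500 ≤ x) :
    asymp (x + 1) - asymp x = Real.exp (logDiff x) / (8 * Real.pi) := by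
  have h0 : 0 < Real.exp (fwd logAsymp x) - 1 := by
    linarith [exp_fwd_sub_one_pos hx, invSqrt_pos (x := x) (by linarith)]
  rw [asymp_eq_exp hx, asymp_eq_exp (by linarith), logDiff, Real.exp_add, Real.exp_log h0,
    fwd, Real.exp_sub]
  field_simp

lemma le_exp_logDiff {x : ℝ} (hx : 2500 ≤ x) :
    4 * Real.exp (Real.pi * √x) * invSqrt x ^ 3 ≤ Real.exp (logDiff x) := by
  have hr := fifty_le_sqrt hx
  have hpi := Real.pi_gt_d2
  have h0 : 0 < Real.pi * √x - 1 := by nlinarith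
  have h1 : 0 < √x := by linarith
  have hp := invSqrt_pos (x := x) (by linarith)
  have h2 : Real.exp (3 * Real.log √x) = √x ^ 3 := by
    rw [mul_comm, Real.exp_mul, Real.exp_log h1]
    norm_cast
  have h3 := exp_fwd_sub_one_pos hx
  have h4 : (Real.pi * √x - 1) / √x ^ 3 * (7 / 5 * invSqrt x) =
      7 / 5 * (Real.pi - invSqrt x) * invSqrt x ^ 3 := by
    rw [invSqrt]
    field_simp
  rw [logDiff, Real.exp_add, Real.exp_log (by linarith), logAsymp, Real.exp_sub, Real.exp_add,
    Real.exp_log h0, h2]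
  calc 4 * Real.exp (Real.pi * √x) * invSqrt x ^ 3
      ≤ 7 / 5 * (Real.pi - invSqrt x) * Real.exp (Real.pi * √x) * invSqrt x ^ 3 := by
        gcongr
        linarith [invSqrt_le hx]
    _ = Real.exp (Real.pi * √x) * ((Real.pi * √x - 1) / √x ^ 3 * (7 / 5 * invSqrt x)) := by
        rw [h4]
        ring
    _ = Real.exp (Real.pi * √x) * (Real.pi * √x - 1) / √x ^ 3 * (7 / 5 * invSqrt x) := by ring
    _ ≤ _ := by gcongr

lemma pow_nine_mul_le_exp {r : ℝ} (hr : 50 ≤ r) : 3500 * r ^ 9 ≤ Real.exp r := by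
  have h1 := Real.pow_div_factorial_le_exp r (by linarith) 40
  refine le_trans ?_ h1
  have h2 : (50 : ℝ) ^ 31 ≤ r ^ 31 := by gcongr
  have h3 : (3500 : ℝ) * (Nat.factorial 40 : ℝ) ≤ 50 ^ 31 := by
    norm_num [Nat.factorial]
  rw [le_div_iff₀ (by positivity)]
  calc 3500 * r ^ 9 * (Nat.factorial 40 : ℝ) = 3500 * (Nat.factorial 40 : ℝ) * r ^ 9 := by ring
    _ ≤ r ^ 31 * r ^ 9 := by
      gcongr
      exact h3.trans h2
    _ = r ^ 40 := by ring

lemma abs_dPbar_sub_le {n : ℕ} (hn : 2500 ≤ n) :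
    |8 * Real.pi * dPbar n - Real.exp (logDiff n)| ≤
      1 / 1000 * invSqrt n ^ 6 * Real.exp (logDiff n) := by
  have hx : (2500 : ℝ) ≤ n := by exact_mod_cast hn
  have hpi := Real.pi_gt_three
  have hpi2 := Real.pi_lt_d2
  have h1 := abs_overpartitionFn_sub_asymp_le (n := n) (by omega)
  have h2 := abs_overpartitionFn_sub_asymp_le (n := n + 1) (by omega)
  have h3 := asymp_sub_asymp_eq_exp hx
  have hL := le_exp_logDiff hx
  have hr := fifty_le_sqrt hx
  push_cast at h2
  have hp : invSqrt n = (√(n : ℝ))⁻¹ := rfl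
  set r := √(n : ℝ) with hrdef
  have hrr : r ^ 2 = n := Real.sq_sqrt (by linarith)
  have h4 : √((n : ℝ) + 1) ≤ r + 1 / 100 := by
    rw [Real.sqrt_le_left (by linarith)]
    nlinarith
  have h5 : Real.exp ((Real.pi - 1) * √((n : ℝ) + 1)) ≤ 11 / 10 * Real.exp ((Real.pi - 1) * r) := by
    have h6 : Real.exp (1 / 20) ≤ 11 / 10 := by
      have := Real.exp_bound_div_one_sub_of_interval (x := 1 / 20) (by norm_num) (by norm_num)
      norm_num at this ⊢
      linarith
    calc _ ≤ Real.exp (1 / 20 + (Real.pi - 1) * r) := Real.exp_le_exp.2 (by nlinarith)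
      _ ≤ _ := by
        rw [Real.exp_add]
        gcongr
  set Y := Real.exp ((Real.pi - 1) * r) with hY
  have hY0 : 0 < Y := Real.exp_pos _
  have h7 : |(dPbar n : ℝ) - (asymp (n + 1) - asymp n)| ≤ 11 / 20 * Y := by
    have e : (dPbar n : ℝ) - (asymp (n + 1) - asymp n) =
        (overpartitionFn (n + 1) - asymp (n + 1)) - (overpartitionFn n - asymp n) := by
      rw [dPbar]
      push_cast
      ring
    rw [e]
    refine (abs_sub _ _).trans ?_
    linarith
  have h8 : 8 * Real.pi * dPbar n - Real.exp (logDiff n) =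
      8 * Real.pi * (dPbar n - (asymp (n + 1) - asymp n)) := by
    rw [h3]
    field_simp
  rw [h8, abs_mul, abs_of_pos (by positivity)]
  have h9 : 8 * Real.pi * |(dPbar n : ℝ) - (asymp (n + 1) - asymp n)| ≤ 14 * Y := by
    have : 8 * Real.pi * |(dPbar n : ℝ) - (asymp (n + 1) - asymp n)| ≤
        8 * 3.15 * (11 / 20 * Y) := by gcongr
    linarith
  refine h9.trans ?_
  have h10 := pow_nine_mul_le_exp hr
  have h11 : Real.exp (Real.pi * r) = Y * Real.exp r := by
    rw [hY, ← Real.exp_add]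
    congr 1
    ring
  have h12 : r * invSqrt n = 1 := by
    rw [hp]
    exact mul_inv_cancel₀ (by linarith)
  have hp0 : 0 < invSqrt n := invSqrt_pos (by linarith)
  calc 14 * Y = 1 / 1000 * invSqrt n ^ 6 * (4 * (Y * (3500 * r ^ 9)) * invSqrt n ^ 3) := by
        have : 1 / 1000 * invSqrt n ^ 6 * (4 * (Y * (3500 * r ^ 9)) * invSqrt n ^ 3) =
          14 * Y * (r * invSqrt n) ^ 9 := by ring
        rw [this, h12]
        ring
    _ ≤ 1 / 1000 * invSqrt n ^ 6 * (4 * (Y * Real.exp r) * invSqrt n ^ 3) := by gcongr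
    _ ≤ _ := by
        rw [← h11]
        gcongr

lemma abs_log_sub_log_le {a b e : ℝ} (hb : 0 < b) (he : e ≤ 1 / 2) (h : |a - b| ≤ e * b) :
    0 < a ∧ |Real.log a - Real.log b| ≤ 2 * e := by
  rw [abs_le] at h
  have ha : 0 < a := by nlinarith
  have hr : 1 - e ≤ a / b := by
    rw [le_div_iff₀ hb]
    linarith
  have hr2 : a / b ≤ 1 + e := by
    rw [div_le_iff₀ hb]
    linarith
  refine ⟨ha, ?_⟩
  rw [← Real.log_div ha.ne' hb.ne', abs_le]
  have h0 : 0 < a / b := by positivity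
  have he0 : 0 ≤ e := by linarith
  constructor
  · refine le_trans ?_ (Real.one_sub_inv_le_log_of_pos h0)
    have : (a / b)⁻¹ ≤ 1 + 2 * e := by
      rw [inv_le_iff_one_le_mul₀ h0]
      nlinarith
    linarith
  · linarith [Real.log_le_sub_one_of_pos h0]

lemma abs_log_dPbar_sub_le {n : ℕ} (hn : 2500 ≤ n) :
    (0 : ℝ) < dPbar n ∧
      |Real.log (dPbar n) - (logDiff n - Real.log (8 * Real.pi))| ≤ 1 / 500 * invSqrt n ^ 6 := by
  have hx : (2500 : ℝ) ≤ n := by exact_mod_cast hn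
  have hp0 : 0 < invSqrt n := invSqrt_pos (by linarith)
  have hp : invSqrt n ^ 6 ≤ 1 := pow_le_one₀ hp0.le (by linarith [invSqrt_le hx])
  obtain ⟨h1, h2⟩ := abs_log_sub_log_le (Real.exp_pos _) (by linarith) (abs_dPbar_sub_le hn)
  have h3 : (0 : ℝ) < dPbar n := by
    have := Real.pi_pos
    exact pos_of_mul_pos_right h1 (by positivity)
  refine ⟨h3, ?_⟩
  rw [Real.log_mul (by positivity) h3.ne', Real.log_exp] at h2
  have e : Real.log (dPbar n) - (logDiff n - Real.log (8 * Real.pi)) =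
      Real.log (8 * Real.pi) + Real.log (dPbar n) - logDiff n := by ring
  rw [e]
  exact h2.trans_eq (by ring)

lemma toeplitz_det_pos_of_log_approx {a0 a1 a2 a3 a4 g0 g1 g2 g3 g4 c Q : ℝ} (h0 : 0 < a0)
    (h1 : 0 < a1) (h2 : 0 < a2) (h3 : 0 < a3) (h4 : 0 < a4) (hQ : 0 < Q) (hQ1 : Q ≤ 1 / 125000)
    (l0 : |Real.log a0 - (g0 - c)| ≤ 1 / 490 * Q ^ 2)
    (l1 : |Real.log a1 - (g1 - c)| ≤ 1 / 490 * Q ^ 2)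
    (l2 : |Real.log a2 - (g2 - c)| ≤ 1 / 490 * Q ^ 2)
    (l3 : |Real.log a3 - (g3 - c)| ≤ 1 / 490 * Q ^ 2)
    (l4 : |Real.log a4 - (g4 - c)| ≤ 1 / 490 * Q ^ 2)
    (d1 : g2 + g0 - 2 * g1 ≤ -(7 / 10) * Q) (d2 : g3 + g1 - 2 * g2 ≤ -(7 / 10) * Q)
    (d3 : g4 + g2 - 2 * g3 ≤ -(7 / 10) * Q)
    (dd : -(21 / 100) * Q ^ 2 ≤
      (g4 + g2 - 2 * g3) + (g2 + g0 - 2 * g1) - 2 * (g3 + g1 - 2 * g2)) :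
    0 < (a2 ^ 2 - a1 * a3) ^ 2 - (a1 ^ 2 - a0 * a2) * (a3 ^ 2 - a2 * a4) := by
  have hQ2 : Q ^ 2 ≤ 1 / 125000 * Q := by nlinarith
  have hQ3 : 0 < Q ^ 2 := by positivity
  rw [abs_le] at l0 l1 l2 l3 l4
  refine toeplitz_det_pos h0 h1 h2 h3 h4 rfl rfl rfl (by linarith) (by linarith) ?_
  have hu : 69 / 100 * Q ≤ Real.log a2 * 2 - Real.log a1 - Real.log a3 := by linarith
  have hu2 := pow_le_pow_left₀ (by positivity) hu 2
  refine lt_of_lt_of_le ?_ hu2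
  rw [mul_pow]
  linarith

lemma det_pos_of_large {n : ℕ} (hn : 2500 ≤ n) :
    0 < Matrix.det !![dPbar (n + 2), dPbar (n + 3), dPbar (n + 4);
                      dPbar (n + 1), dPbar (n + 2), dPbar (n + 3);
                      dPbar n,       dPbar (n + 1), dPbar (n + 2)] := by
  have hx : (2500 : ℝ) ≤ n := by exact_mod_cast hn
  set q := invSqrt (n + 4) with hq
  have hq0 : 0 < q := invSqrt_pos (by linarith)
  have hnq : invSqrt n ^ 6 ≤ 51 / 50 * q ^ 6 := by
    have e1 : invSqrt n ^ 6 = (1 / (n : ℝ)) ^ 3 := by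
      rw [one_div, ← invSqrt_sq (by linarith)]
      ring
    have e2 : q ^ 6 = (1 / ((n : ℝ) + 4)) ^ 3 := by
      rw [one_div, ← invSqrt_sq (by linarith)]
      ring
    have e3 : 1 / (n : ℝ) ≤ 501 / 500 * (1 / ((n : ℝ) + 4)) := by
      rw [← div_eq_mul_one_div, div_le_div_iff₀ (by linarith) (by linarith)]
      linarith
    rw [e1, e2]
    calc (1 / (n : ℝ)) ^ 3 ≤ (501 / 500 * (1 / ((n : ℝ) + 4))) ^ 3 := by gcongr
      _ = (501 / 500) ^ 3 * (1 / ((n : ℝ) + 4)) ^ 3 := by ring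
      _ ≤ _ := by gcongr; norm_num
  have hlog : ∀ i : ℕ, (0 : ℝ) < dPbar (n + i) ∧
      |Real.log (dPbar (n + i)) - (logDiff (n + i) - Real.log (8 * Real.pi))| ≤
        1 / 490 * (q ^ 3) ^ 2 := by
    intro i
    obtain ⟨h1, h2⟩ := abs_log_dPbar_sub_le (n := n + i) (by omega)
    refine ⟨h1, ?_⟩
    push_cast at h2
    refine h2.trans ?_
    have h3 : invSqrt ((n : ℝ) + i) ^ 6 ≤ invSqrt n ^ 6 := by
      refine pow_le_pow_left₀ (invSqrt_pos (by positivity)).le (invSqrt_anti (by linarith) ?_) 6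
      linarith [Nat.cast_nonneg (α := ℝ) i]
    have : 0 < q ^ 6 := by positivity
    rw [← pow_mul]
    linarith
  have hd : ∀ i : ℝ, 1 ≤ i → i ≤ 3 → secondDiff logDiff (n + i) ≤ -(7 / 10) * q ^ 3 := by
    intro i hi1 hi3
    refine (secondDiff_logDiff_le (by linarith)).trans ?_
    have : q ^ 3 ≤ invSqrt ((n : ℝ) + i + 1) ^ 3 :=
      pow_le_pow_left₀ hq0.le (invSqrt_anti (by linarith) (by linarith)) 3
    linarith
  have e1 : secondDiff logDiff (n + 1) = logDiff (n + 2) + logDiff n - 2 * logDiff (n + 1) := by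
    rw [secondDiff]
    ring_nf
  have e2 : secondDiff logDiff (n + 2) =
      logDiff (n + 3) + logDiff (n + 1) - 2 * logDiff (n + 2) := by
    rw [secondDiff]
    ring_nf
  have e3 : secondDiff logDiff (n + 3) =
      logDiff (n + 4) + logDiff (n + 2) - 2 * logDiff (n + 3) := by
    rw [secondDiff]
    ring_nf
  have e4 : secondDiff (secondDiff logDiff) (n + 2) = secondDiff logDiff (n + 3) +
      secondDiff logDiff (n + 1) - 2 * secondDiff logDiff (n + 2) := by
    rw [secondDiff]
    ring_nf
  have dd := le_secondDiff_secondDiff_logDiff (x := (n : ℝ) + 2) (by linarith)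
  rw [e4, e1, e2, e3, add_sub_cancel_right] at dd
  have hq3 : q ^ 3 ≤ 1 / 125000 := by
    have := pow_le_pow_left₀ hq0.le (invSqrt_le (x := (n : ℝ) + 4) (by linarith)) 3
    norm_num at this ⊢
    linarith
  have hq6 : 0 < q ^ 6 := by positivity
  have h0 : (0 : ℝ) < dPbar n ∧ |Real.log (dPbar n) - (logDiff n - Real.log (8 * Real.pi))| ≤
      1 / 490 * (q ^ 3) ^ 2 := by simpa using hlog 0
  have key := toeplitz_det_pos_of_log_approx h0.1 (hlog 1).1 (hlog 2).1 (hlog 3).1 (hlog 4).1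
    (Q := q ^ 3) (by positivity) hq3 h0.2 (hlog 1).2 (hlog 2).2 (hlog 3).2 (hlog 4).2
    (by simpa [e1] using hd 1 le_rfl (by norm_num))
    (by simpa [e2] using hd 2 (by norm_num) (by norm_num))
    (by simpa [e3] using hd 3 (by norm_num) le_rfl)
    (by
      rw [← pow_mul]
      push_cast
      linarith)
  have h2 : 0 < dPbar (n + 2) := by exact_mod_cast (hlog 2).1
  refine pos_of_mul_pos_left (b := dPbar (n + 2)) ?_ h2.le
  have key' : 0 < (dPbar (n + 2) ^ 2 - dPbar (n + 1) * dPbar (n + 3)) ^ 2 -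
      (dPbar (n + 1) ^ 2 - dPbar n * dPbar (n + 2)) *
        (dPbar (n + 3) ^ 2 - dPbar (n + 2) * dPbar (n + 4)) := by exact_mod_cast key
  refine key'.trans_eq ?_
  rw [Matrix.det_fin_three]
  simp
  ring

end LargeIndex

section SmallIndex

/-- The coefficients of the theta series, as integers. -/
def thetaCoeff (n : ℕ) : ℤ := if n = 0 then 1 else if IsSquare n then 2 * (-1) ^ n else 0

lemma sum_overpartitionFn_mul_thetaCoeff (n : ℕ) :
    ∑ ij ∈ Finset.HasAntidiagonal.antidiagonal n, (overpartitionFn ij.1 : ℤ) * thetaCoeff ij.2 =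
      if n = 0 then 1 else 0 := by
  have h := congrArg (PowerSeries.coeff n) series_mul_thetaSeries
  rw [PowerSeries.coeff_mul, PowerSeries.coeff_one] at h
  simp only [series, thetaSeries, PowerSeries.coeff_mk] at h
  have h2 : ∀ k, (if k = 0 then 1 else if IsSquare k then 2 * (-1) ^ k else 0 : ℝ) =
      thetaCoeff k := by
    intro k
    rw [thetaCoeff]
    push_cast
    rfl
  simp only [h2] at h
  exact_mod_cast h

lemma abs_thetaCoeff_le (n : ℕ) : |thetaCoeff n| ≤ 2 := by
  rw [thetaCoeff]
  split_ifs <;> simp [abs_mul]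

lemma overpartitionFn_le_two_mul_sum {n : ℕ} (hn : n ≠ 0) :
    overpartitionFn n ≤ 2 * ∑ i ∈ Finset.range n, overpartitionFn i := by
  have h := sum_overpartitionFn_mul_thetaCoeff n
  rw [if_neg hn, Finset.Nat.sum_antidiagonal_eq_sum_range_succ_mk, Finset.sum_range_succ,
    Nat.sub_self] at h
  have h2 : thetaCoeff 0 = 1 := rfl
  have h3 : (overpartitionFn n : ℤ) =
      ∑ i ∈ Finset.range n, (overpartitionFn i : ℤ) * -thetaCoeff (n - i) := by
    rw [h2] at h
    simp only [mul_neg, Finset.sum_neg_distrib]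
    linarith
  zify
  rw [h3, Finset.mul_sum]
  refine Finset.sum_le_sum fun i _ => ?_
  rw [mul_comm]
  gcongr
  exact (neg_le_abs _).trans (abs_thetaCoeff_le _)

lemma pow_dvd_sum_mul_sum_sub_one (x : ℤ) (N : ℕ) :
    x ^ N ∣ (∑ i ∈ Finset.range N, (overpartitionFn i : ℤ) * x ^ i) *
      (∑ j ∈ Finset.range N, thetaCoeff j * x ^ j) - 1 := by
  let f (c : ℕ → ℤ) : Polynomial ℤ :=
    ∑ i ∈ Finset.range N, Polynomial.C (c i) * Polynomial.X ^ i
  have hc : ∀ c, ∀ n < N, (f c).coeff n = c n := by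
    intro c n hn
    simp [f, hn]
  have h : (Polynomial.X : Polynomial ℤ) ^ N ∣
      f (fun i => overpartitionFn i) * f thetaCoeff - 1 := by
    rw [Polynomial.X_pow_dvd_iff]
    intro d hd
    rw [Polynomial.coeff_sub, Polynomial.coeff_mul, Polynomial.coeff_one, sub_eq_zero,
      ← sum_overpartitionFn_mul_thetaCoeff]
    refine Finset.sum_congr rfl fun ij hij => ?_
    have := Finset.HasAntidiagonal.mem_antidiagonal.1 hij
    rw [hc _ _ (by omega), hc _ _ (by omega)]
  have h2 := Polynomial.eval_dvd (x := x) h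
  simpa [f, Polynomial.eval_finsetSum] using h2

lemma sum_thetaCoeff_mul_pow (x : ℤ) (K : ℕ) :
    ∑ j ∈ Finset.range ((K + 1) ^ 2), thetaCoeff j * x ^ j =
      1 + ∑ k ∈ Finset.range K, 2 * (-1) ^ (k + 1) * x ^ ((k + 1) ^ 2) := by
  induction K with
  | zero => simp [thetaCoeff]
  | succ K ih =>
    have e : (K + 1 + 1) ^ 2 = (K + 1) ^ 2 + ((2 * K + 2) + 1) := by ring
    have h0 : ∑ j ∈ Finset.range (2 * K + 2),
        thetaCoeff ((K + 1) ^ 2 + (j + 1)) * x ^ ((K + 1) ^ 2 + (j + 1)) = 0 := by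
      refine Finset.sum_eq_zero fun j hj => ?_
      have hj := Finset.mem_range.1 hj
      have h : ¬ IsSquare ((K + 1) ^ 2 + (j + 1)) := by
        rintro ⟨m, hm⟩
        have h1 : K + 1 < m := by nlinarith
        have h2 : m < K + 2 := by nlinarith
        omega
      rw [thetaCoeff, if_neg (by positivity), if_neg h, zero_mul]
    have h1 : (-1 : ℤ) ^ (K + 1) ^ 2 = (-1) ^ (K + 1) := by
      rcases Nat.even_or_odd (K + 1) with h | h
      · rw [h.neg_one_pow, (h.pow_of_ne_zero two_ne_zero).neg_one_pow]
      · rw [h.neg_one_pow, h.pow.neg_one_pow]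
    have h2 : thetaCoeff ((K + 1) ^ 2) = 2 * (-1) ^ (K + 1) := by
      rw [thetaCoeff, if_neg (by positivity), if_pos (IsSquare.sq _), h1]
    rw [e, Finset.sum_range_add, ih, Finset.sum_range_succ', h0, Finset.sum_range_succ _ K,
      add_zero, h2]
    ring

lemma sum_mul_pow_lt {d : ℕ → ℕ} {x n : ℕ} (hd : ∀ i < n, d i < x) :
    ∑ i ∈ Finset.range n, d i * x ^ i < x ^ n := by
  induction n with
  | zero => simp
  | succ n ih =>
    rw [Finset.sum_range_succ, pow_succ]
    have h1 := ih fun i hi => hd i (by omega)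
    have h2 : (d n + 1) * x ^ n ≤ x * x ^ n := Nat.mul_le_mul_right _ (hd n (by omega))
    linarith

/-- If the truncated generating function at `x` agrees with `P` modulo `x ^ N` and the base `x`
digits of `P` are small enough, then they are the values of the overpartition function. -/
lemma overpartitionFn_eq_digit {P x N m c : ℕ} (hx : 1 < x) (hmN : m ≤ N)
    (hP : (x : ℤ) ^ N ∣ P - ∑ i ∈ Finset.range N, (overpartitionFn i : ℤ) * (x : ℤ) ^ i)
    (hc : ∀ n < m, P / x ^ n % x ≤ c) (hcx : 2 * (m * c) < x) :
    ∀ n < m, overpartitionFn n = P / x ^ n % x := by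
  intro n
  induction n using Nat.strong_induction_on with
  | _ n ih =>
  intro hn
  have hle : ∀ i < n, overpartitionFn i ≤ c := fun i hi => by
    rw [ih i hi (by omega)]
    exact hc i (by omega)
  have hlt : ∀ i < n + 1, overpartitionFn i < x := by
    intro i hi
    rcases Nat.eq_zero_or_pos i with rfl | hi0
    · simpa [overpartitionFn] using hx
    refine (overpartitionFn_le_two_mul_sum hi0.ne').trans_lt (lt_of_le_of_lt ?_ hcx)
    gcongr
    calc ∑ j ∈ Finset.range i, overpartitionFn j ≤ ∑ j ∈ Finset.range i, c :=
          Finset.sum_le_sum fun j hj => hle j (by have := Finset.mem_range.1 hj; omega)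
      _ = i * c := by simp
      _ ≤ m * c := by gcongr; omega
  have hdvd : (x : ℤ) ^ (n + 1) ∣
      P - ∑ i ∈ Finset.range (n + 1), (overpartitionFn i : ℤ) * (x : ℤ) ^ i := by
    have h1 := (pow_dvd_pow (x : ℤ) (show n + 1 ≤ N by omega)).trans hP
    obtain ⟨r, rfl⟩ := Nat.exists_eq_add_of_le (show n + 1 ≤ N by omega)
    rw [Finset.sum_range_add] at h1
    have h2 : (x : ℤ) ^ (n + 1) ∣ ∑ i ∈ Finset.range r,
        (overpartitionFn (n + 1 + i) : ℤ) * (x : ℤ) ^ (n + 1 + i) :=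
      Finset.dvd_sum fun i _ => Dvd.dvd.mul_left (pow_dvd_pow _ (by omega)) _
    have h3 := dvd_add h1 h2
    rwa [← sub_sub, sub_add_cancel] at h3
  have hmod : P % x ^ (n + 1) = ∑ i ∈ Finset.range (n + 1), overpartitionFn i * x ^ i := by
    rw [← Nat.mod_eq_of_lt (sum_mul_pow_lt hlt)]
    refine ((Nat.modEq_iff_dvd).2 ?_).symm
    push_cast
    exact hdvd
  have hdiv := Nat.mod_mul_right_div_self P (x ^ n) x
  rw [← pow_succ, hmod, Finset.sum_range_succ,
    Nat.add_mul_div_right _ _ (by positivity),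
    Nat.div_eq_of_lt (sum_mul_pow_lt fun i hi => hlt i (by omega)), zero_add] at hdiv
  exact hdiv

end SmallIndex

section Computation

/-- The sum of `2 * x ^ (k ^ 2)` over the `k` in `[1, K]` with `k % 2 = p`. -/
def thetaPart (x p : ℕ) : ℕ → ℕ
  | 0 => 0
  | k + 1 => thetaPart x p k + if (k + 1) % 2 = p then 2 * x ^ ((k + 1) ^ 2) else 0

/-- Newton iteration for the inverse of `1 + e - o` modulo `M`. -/
def newton (e o M : ℕ) : ℕ → ℕ
  | 0 => 1
  | j + 1 => newton e o M j *
      (2 + newton e o M j * o + (M - newton e o M j * (1 + e) % M)) % M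

/-- Application of a function to a natural number, in a form which makes the kernel evaluate the
number first. -/
def applyEval (n : ℕ) (f : ℕ → Bool) : Bool := Nat.rec (f 0) (fun m _ => f (m + 1)) n

lemma applyEval_eq (n : ℕ) (f : ℕ → Bool) : applyEval n f = f n := by
  cases n <;> rfl

/-- Whether the `3 × 3` Toeplitz determinant of five numbers is positive. -/
def toeplitzCheck (a0 a1 a2 a3 a4 : ℕ) : Bool :=
  Nat.blt (2 * (a1 * a2 * a3) + a4 * a2 * a0) (a2 ^ 3 + a3 ^ 2 * a0 + a4 * a1 ^ 2)

/-- `toeplitzCheck` for the differences of the six base `x` digits of `w`. -/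
def windowCheck (x w : ℕ) : Bool :=
  toeplitzCheck (w / x ^ 1 % x - w / x ^ 0 % x) (w / x ^ 2 % x - w / x ^ 1 % x)
    (w / x ^ 3 % x - w / x ^ 2 % x) (w / x ^ 4 % x - w / x ^ 3 % x)
    (w / x ^ 5 % x - w / x ^ 4 % x)

/-- The `n`th base `x` digit of `P` is at most `c` and at most the next digit, and the determinant
condition holds from there if `62 ≤ n`. -/
def digitCheck (x c P n : ℕ) : Bool :=
  applyEval (P / x ^ n % x ^ 6) fun w =>
    Nat.ble (w / x ^ 0 % x) c && (Nat.ble (w / x ^ 0 % x) (w / x ^ 1 % x) &&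
      (Nat.blt n 62 || windowCheck x w))

/-- `digitCheck` for all positions below a bound. -/
def digitsCheck (x c P : ℕ) : ℕ → Bool
  | 0 => true
  | n + 1 => digitCheck x c P n && digitsCheck x c P n

/-- Computation of the inverse of the theta series at `x` modulo a power of `x`, with a check of the
result and of its digits. -/
def inverseThetaCheck (x c m K : ℕ) : Bool :=
  applyEval (x ^ (K + 1) ^ 2) fun M =>
    applyEval (thetaPart x 0 K) fun e =>
      applyEval (thetaPart x 1 K) fun o =>
        applyEval (newton e o M 12) fun P =>
          Nat.beq (P * (1 + e) % M) ((1 + P * o) % M) && digitsCheck x c P m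

lemma inverseThetaCheck_eq_true : inverseThetaCheck (2 ^ 256) (2 ^ 240) 2510 50 = true := by
  decide +kernel

lemma thetaPart_sub_thetaPart (x K : ℕ) :
    1 + (thetaPart x 0 K : ℤ) - thetaPart x 1 K =
      ∑ j ∈ Finset.range ((K + 1) ^ 2), thetaCoeff j * (x : ℤ) ^ j := by
  rw [sum_thetaCoeff_mul_pow]
  induction K with
  | zero => simp [thetaPart]
  | succ K ih =>
    rw [Finset.sum_range_succ, ← add_assoc, ← ih, thetaPart, thetaPart]
    rcases Nat.mod_two_eq_zero_or_one (K + 1) with h | h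
    · rw [if_pos h, if_neg (by omega), (Nat.even_iff.2 h).neg_one_pow]
      push_cast
      ring
    · rw [if_neg (by omega), if_pos h, (Nat.odd_iff.2 h).neg_one_pow]
      push_cast
      ring

lemma mod_pow_div_pow_mod (a x : ℕ) {i k : ℕ} (h : i < k) :
    a % x ^ k / x ^ i % x = a / x ^ i % x := by
  obtain ⟨r, rfl⟩ := Nat.exists_eq_add_of_lt h
  rw [add_assoc, pow_add x i, Nat.mod_mul_right_div_self,
    Nat.mod_mod_of_dvd _ (dvd_pow_self x (by omega))]

lemma digitCheck_of_digitsCheck {x c P m : ℕ} (h : digitsCheck x c P m = true) :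
    ∀ n < m, digitCheck x c P n = true := by
  induction m with
  | zero => simp
  | succ m ih =>
    rw [digitsCheck, Bool.and_eq_true] at h
    intro n hn
    rcases Nat.lt_succ_iff_lt_or_eq.1 hn with h1 | rfl
    · exact ih h.2 n h1
    · exact h.1

lemma of_digitCheck {x c P n : ℕ} (h : digitCheck x c P n = true) :
    P / x ^ n % x ≤ c ∧ P / x ^ n % x ≤ P / x ^ (n + 1) % x ∧
      (62 ≤ n → toeplitzCheck (P / x ^ (n + 1) % x - P / x ^ n % x)
        (P / x ^ (n + 2) % x - P / x ^ (n + 1) % x) (P / x ^ (n + 3) % x - P / x ^ (n + 2) % x)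
        (P / x ^ (n + 4) % x - P / x ^ (n + 3) % x)
        (P / x ^ (n + 5) % x - P / x ^ (n + 4) % x) = true) := by
  have e : ∀ i < 6, P / x ^ n % x ^ 6 / x ^ i % x = P / x ^ (n + i) % x := fun i hi => by
    rw [mod_pow_div_pow_mod _ _ hi, Nat.div_div_eq_div_mul, ← pow_add]
  rw [digitCheck, applyEval_eq, windowCheck, e 0 (by norm_num), e 1 (by norm_num),
    e 2 (by norm_num), e 3 (by norm_num), e 4 (by norm_num), e 5 (by norm_num)] at h
  simp only [Bool.and_eq_true, Bool.or_eq_true, Nat.ble_eq, Nat.blt_eq, add_zero] at h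
  exact ⟨h.1, h.2.1, fun hn => h.2.2.resolve_left (by omega)⟩

lemma overpartitionFn_of_inverseThetaCheck {x c m K : ℕ} (hx : 1 < x) (hm : m ≤ (K + 1) ^ 2)
    (hcx : 2 * (m * c) < x) (h : inverseThetaCheck x c m K = true) :
    ∃ P, (∀ n < m, overpartitionFn n = P / x ^ n % x) ∧ ∀ n < m, digitCheck x c P n = true := by
  simp only [inverseThetaCheck, applyEval_eq, Bool.and_eq_true, Nat.beq_eq] at h
  obtain ⟨h1, h2⟩ := h
  set P := newton (thetaPart x 0 K) (thetaPart x 1 K) (x ^ (K + 1) ^ 2) 12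
  have h3 := digitCheck_of_digitsCheck h2
  refine ⟨P, overpartitionFn_eq_digit hx hm ?_ (fun n hn => (of_digitCheck (h3 n hn)).1) hcx, h3⟩
  have h4 : (x : ℤ) ^ (K + 1) ^ 2 ∣
      P * (1 + (thetaPart x 0 K : ℤ) - thetaPart x 1 K) - 1 := by
    have h5 := (Nat.modEq_iff_dvd).1 (Eq.symm h1)
    push_cast at h5
    refine h5.trans (dvd_of_eq (by ring))
  rw [thetaPart_sub_thetaPart] at h4
  have h6 := pow_dvd_sum_mul_sum_sub_one (x : ℤ) ((K + 1) ^ 2)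
  have h7 := dvd_sub (h4.mul_left
    (∑ i ∈ Finset.range ((K + 1) ^ 2), (overpartitionFn i : ℤ) * (x : ℤ) ^ i)) (h6.mul_left P)
  refine h7.trans (dvd_of_eq (by ring))

lemma det_pos_of_small {n : ℕ} (hn : 62 ≤ n) (hn2 : n < 2500) :
    0 < Matrix.det !![dPbar (n + 2), dPbar (n + 3), dPbar (n + 4);
                      dPbar (n + 1), dPbar (n + 2), dPbar (n + 3);
                      dPbar n,       dPbar (n + 1), dPbar (n + 2)] := by
  obtain ⟨P, h1, h2⟩ := overpartitionFn_of_inverseThetaCheck (by norm_num) (by norm_num)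
    (by norm_num) inverseThetaCheck_eq_true
  have hd : ∀ k < 2509, dPbar k = (overpartitionFn (k + 1) - overpartitionFn k : ℕ) := by
    intro k hk
    have := (of_digitCheck (h2 k (by omega))).2.1
    rw [← h1 k (by omega), ← h1 (k + 1) (by omega)] at this
    rw [dPbar, Nat.cast_sub this]
  have h3 := (of_digitCheck (h2 n (by omega))).2.2 hn
  rw [← h1 n (by omega), ← h1 (n + 1) (by omega), ← h1 (n + 2) (by omega),
    ← h1 (n + 3) (by omega), ← h1 (n + 4) (by omega), ← h1 (n + 5) (by omega)] at h3
  have h4 := hd n (by omega)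
  have h5 := hd (n + 1) (by omega)
  have h6 := hd (n + 2) (by omega)
  have h7 := hd (n + 3) (by omega)
  have h8 := hd (n + 4) (by omega)
  rw [toeplitzCheck, Nat.blt_eq] at h3
  zify at h3
  simp only [add_assoc, Nat.reduceAdd] at h5 h6 h7 h8
  rw [← h4, ← h5, ← h6, ← h7, ← h8] at h3
  rw [Matrix.det_fin_three]
  simp
  linarith

end Computation

end Overpartition

theorem det3_dPbar (n : ℕ) (hn : 62 ≤ n) :
    (Matrix.det !![dPbar (n + 2), dPbar (n + 3), dPbar (n + 4);
                   dPbar (n + 1), dPbar (n + 2), dPbar (n + 3);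
                   dPbar n,       dPbar (n + 1), dPbar (n + 2)]) > 0 := by
  rcases lt_or_ge n 2500 with h | h
  · exact Overpartition.det_pos_of_small hn h
  · exact Overpartition.det_pos_of_large h
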